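/- Under the stated assumptions on ξ, ε, the cycle weights (so that either α_j → α > 0 with ∑_j |α_j − α| < ∞, or α_j → α ≤ 0 with ∑_j j^{−1}|α_j − α| < ∞), and for any fixed density ρ > 0, the fraction of points in infinite cycles satisfies ν = max(0, 1 − ρ_c/ρ). -/

import Mathlib

open MeasureTheory Filter Topology ENNReal FourierTransform

noncomputable section

/-! ### Permutation combinatorics -/

/-- `r_j(π)`: the number of cycles of length `j` in `π ∈ S_N`
(fixed points count as cycles of length 1). -/
def cycCount {N : ℕ} (π : Equiv.Perm (Fin N)) (j : ℕ) : ℕ :=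
  if j = 1 then N - π.cycleType.sum else Multiset.count j π.cycleType

/-- The cycle weight `exp(-∑_{j≥1} α_j r_j(π))` of a permutation `π ∈ S_N`. -/
def permWeight (α : ℕ → ℝ) {N : ℕ} (π : Equiv.Perm (Fin N)) : ℝ :=
  Real.exp (-∑ j ∈ Finset.Icc 1 N, α j * (cycCount π j : ℝ))

/-! ### The spatial model -/

/-- Euclidean space `ℝ^d`. -/
abbrev Eu (d : ℕ) := EuclideanSpace ℝ (Fin d)

/-- The lattice point `Lz ∈ ℝ^d`, for `z ∈ ℤ^d`. -/
def latPt (d : ℕ) (L : ℝ) (z : Fin d → ℤ) : Eu d :=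
  (WithLp.equiv 2 (Fin d → ℝ)).symm (fun i => L * (z i))

/-- The dual lattice point `z/L ∈ Λ* = L⁻¹ℤ^d`, for `z ∈ ℤ^d`. -/
def dualPt (d : ℕ) (L : ℝ) (z : Fin d → ℤ) : Eu d :=
  (WithLp.equiv 2 (Fin d → ℝ)).symm (fun i => (z i) / L)

/-- The cube `Λ ⊆ ℝ^d` of side `L`. -/
def cube (d : ℕ) (L : ℝ) : Set (Eu d) := {x | ∀ i, x i ∈ Set.Ico (0:ℝ) L}

/-- The periodization `e^{-ξ_Λ(x)} = ∑_{z∈ℤ^d} e^{-ξ(x-Lz)}` (values in `[0,∞]`),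
where `f = e^{-ξ}`. -/
def fper (d : ℕ) (f : Eu d → ℝ) (L : ℝ) (x : Eu d) : ℝ≥0∞ :=
  ∑' z : Fin d → ℤ, ENNReal.ofReal (f (x - latPt d L z))

/-- The (unnormalized) Gibbs weight of a permutation `π ∈ S_N`:
`e^{-∑_j α_j r_j(π)} ∫_{Λ^N} ∏_i e^{-ξ_Λ(x_i - x_{π(i)})} dx`. -/
def gibbsW (d : ℕ) (f : Eu d → ℝ) (α : ℕ → ℝ) (L : ℝ) (N : ℕ)
    (π : Equiv.Perm (Fin N)) : ℝ≥0∞ :=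
  ENNReal.ofReal (permWeight α π) *
    ∫⁻ x in Set.univ.pi (fun _ : Fin N => cube d L), ∏ i, fper d f L (x i - x (π i))

/-- The expectation, under the Gibbs measure on `Λ^N × S_N`, of a function of the
permutation alone. -/
def gibbsE (d : ℕ) (f : Eu d → ℝ) (α : ℕ → ℝ) (L : ℝ) (N : ℕ)
    (g : Equiv.Perm (Fin N) → ℝ) : ℝ :=
  (∑ π : Equiv.Perm (Fin N), (gibbsW d f α L N π).toReal * g π) /
    (∑ π : Equiv.Perm (Fin N), (gibbsW d f α L N π).toReal)

/-- The critical density `ρ_c = ∑_{j≥1} e^{-α_j} ∫_{ℝ^d} e^{-jε(k)} dk`. -/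
def rhoC (d : ℕ) (ε : Eu d → ℝ) (α : ℕ → ℝ) : ℝ :=
  ∑' j : ℕ, Real.exp (-α (j+1)) * ∫ k : Eu d, Real.exp (-(((j:ℝ)+1) * ε k))

/-! ### Sequences generated by cycle weights -/

/-- `h` is the sequence of normalized partition functions with cycle weights `θ`: it satisfies
`h 0 = 1` and `n h n = ∑_{i+j=n} θ i h j`. -/
structure IsCycleSeq (θ h : ℕ → ℝ) : Prop where
  zero : h 0 = 1
  theta_zero : θ 0 = 0
  theta_nonneg : ∀ j, 0 ≤ θ j
  recurrence : ∀ n : ℕ, (n : ℝ) * h n = ∑ p ∈ Finset.HasAntidiagonal.antidiagonal n, θ p.1 * h p.2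

namespace IsCycleSeq

variable {θ h : ℕ → ℝ}

lemma recurrence_succ (H : IsCycleSeq θ h) (n : ℕ) :
    ((n : ℝ) + 1) * h (n + 1) = ∑ p ∈ Finset.HasAntidiagonal.antidiagonal n, θ (p.1 + 1) * h p.2 := by
  have := H.recurrence (n + 1)
  rw [Finset.Nat.sum_antidiagonal_succ, H.theta_zero, zero_mul, zero_add] at this
  exact_mod_cast this

lemma nonneg (H : IsCycleSeq θ h) (n : ℕ) : 0 ≤ h n := by
  induction n using Nat.strong_induction_on with
  | _ n ih =>
    rcases n with _ | n
    · rw [H.zero]; exact zero_le_one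
    · have h1 : 0 ≤ ((n : ℝ) + 1) * h (n + 1) := by
        rw [H.recurrence_succ]
        refine Finset.sum_nonneg fun p hp => mul_nonneg (H.theta_nonneg _) (ih _ ?_)
        have := Finset.HasAntidiagonal.mem_antidiagonal.1 hp
        omega
      exact nonneg_of_mul_nonneg_right h1 (by positivity)

lemma le_choose (H : IsCycleSeq θ h) {k : ℕ} (hk : ∀ j, θ j ≤ k + 1) (n : ℕ) :
    h n ≤ ((n + k).choose k : ℝ) := by
  induction n using Nat.strong_induction_on with
  | _ n ih =>
    rcases n with _ | n
    · simp [H.zero]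
    · have h1 : ((n : ℝ) + 1) * h (n + 1) ≤ ((n : ℝ) + 1) * ((n + 1 + k).choose k : ℝ) := by
        rw [H.recurrence_succ]
        calc ∑ p ∈ Finset.HasAntidiagonal.antidiagonal n, θ (p.1 + 1) * h p.2
            ≤ ∑ p ∈ Finset.HasAntidiagonal.antidiagonal n, ((k : ℝ) + 1) * ((p.2 + k).choose k : ℝ) := by
              refine Finset.sum_le_sum fun p hp => ?_
              have := Finset.HasAntidiagonal.mem_antidiagonal.1 hp
              exact mul_le_mul (hk _) (ih _ (by omega)) (H.nonneg _) (by positivity)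
          _ = ((k : ℝ) + 1) * ∑ i ∈ Finset.range (n + 1), ((i + k).choose k : ℝ) := by
              rw [← Finset.mul_sum, Finset.Nat.sum_antidiagonal_eq_sum_range_succ_mk,
                ← Finset.sum_range_reflect]
              congr 1
              refine Finset.sum_congr rfl fun i hi => ?_
              have := Finset.mem_range.1 hi
              congr 3
              simp only [Nat.succ_eq_add_one]
              omega
          _ = ((n : ℝ) + 1) * ((n + 1 + k).choose k : ℝ) := by
              have e1 := Nat.sum_range_add_choose n k
              have e2 := Nat.choose_succ_right_eq (n + k + 1) k
              have e3 : n + k + 1 - k = n + 1 := by omega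
              rw [e3, ← e1] at e2
              have e4 : n + 1 + k = n + k + 1 := by omega
              rw [e4]
              have e5 := congrArg (Nat.cast : ℕ → ℝ) e2
              push_cast at e5
              linarith
      exact le_of_mul_le_mul_left h1 (by positivity)

lemma summable_mul_pow (H : IsCycleSeq θ h) {C : ℝ} (hC : ∀ j, θ j ≤ C) {z : ℝ} (hz0 : 0 ≤ z)
    (hz1 : z < 1) : Summable fun n => h n * z ^ n := by
  obtain ⟨k, hk⟩ := exists_nat_ge C
  refine Summable.of_nonneg_of_le (fun n => mul_nonneg (H.nonneg n) (by positivity)) (fun n => ?_)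
    (summable_choose_mul_geometric_of_norm_lt_one k (r := z)
      (by rwa [Real.norm_of_nonneg hz0]))
  exact mul_le_mul_of_nonneg_right (H.le_choose (fun j => by linarith [hC j]) n) (by positivity)

end IsCycleSeq

/-- Summability of a power series with polynomial factors inside its disc of convergence. -/
lemma summable_pow_mul_of_forall_summable {a : ℕ → ℝ}
    (ha : ∀ r : ℝ, 0 ≤ r → r < 1 → Summable fun n => a n * r ^ n) (p : ℕ) {z : ℝ} (hz0 : 0 ≤ z)
    (hz1 : z < 1) : Summable fun n : ℕ => (n : ℝ) ^ p * (a n * z ^ n) := by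
  obtain ⟨r, hr0, hr1⟩ := exists_between hz1
  have hrpos : 0 < r := lt_of_le_of_lt hz0 hr0
  refine summable_of_isBigO_nat (ha r hrpos.le hr1) ?_
  have h1 : Tendsto (fun n : ℕ => (n : ℝ) ^ p * (z / r) ^ n) atTop (𝓝 0) :=
    tendsto_pow_const_mul_const_pow_of_lt_one p (by positivity) ((div_lt_one hrpos).2 hr0)
  have h2 := (h1.isBigO_one ℝ).mul (Asymptotics.isBigO_refl (fun n : ℕ => a n * r ^ n) atTop)
  refine (h2.congr (fun n => ?_) (fun n => one_mul _))
  rw [div_pow]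
  field_simp

/-- Termwise differentiation of a real power series with radius of convergence at least one. -/
lemma hasDerivAt_tsum_mul_pow {a : ℕ → ℝ}
    (ha : ∀ r : ℝ, 0 ≤ r → r < 1 → Summable fun n => |a n| * r ^ n) {z : ℝ} (hz : |z| < 1) :
    HasDerivAt (fun t : ℝ => ∑' n, a n * t ^ n) (∑' n : ℕ, ((n : ℝ) + 1) * a (n + 1) * z ^ n) z := by
  obtain ⟨r, hr0, hr1⟩ := exists_between hz
  have hrpos : 0 < r := lt_of_le_of_lt (abs_nonneg z) hr0
  have hs : Summable fun n : ℕ => (n : ℝ) * |a n| * r ^ (n - 1) := by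
    have := (summable_pow_mul_of_forall_summable ha 1 hrpos.le hr1).mul_right r⁻¹
    refine this.congr fun n => ?_
    rcases n with _ | n
    · simp
    · rw [pow_succ]
      simp only [Nat.add_sub_cancel]
      field_simp
      ring
  have key := hasDerivAt_tsum_of_isPreconnected (𝕜 := ℝ) (g := fun n t => a n * t ^ n)
    (g' := fun n t => a n * ((n : ℝ) * t ^ (n - 1))) (y₀ := 0) (y := z) hs
    (Metric.isOpen_ball (x := (0 : ℝ)) (ε := r)) (convex_ball (0 : ℝ) r).isPreconnected
    (fun n y _ => (hasDerivAt_pow n y).const_mul (a n)) (fun n y hy => ?_)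
    (Metric.mem_ball_self hrpos) ?_ (by simpa using hr0)
  · refine key.congr_deriv ?_
    rw [tsum_eq_zero_add']
    · simp only [Nat.cast_zero, zero_mul, mul_zero, zero_add, Nat.cast_add, Nat.cast_one,
        Nat.add_sub_cancel]
      exact tsum_congr fun n => by ring
    · refine Summable.of_norm_bounded (((summable_nat_add_iff 1).2 hs)) fun n => ?_
      simp only [norm_mul, Real.norm_eq_abs, Nat.add_sub_cancel, norm_pow, Nat.abs_cast]
      rw [mul_left_comm, ← mul_assoc]
      gcongr
  · have hy' : |y| < r := by simpa using hy
    simp only [norm_mul, Real.norm_eq_abs, norm_pow, Nat.abs_cast]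
    rw [mul_left_comm, ← mul_assoc]
    gcongr
  · refine summable_of_ne_finset_zero (s := {0}) fun n hn => ?_
    simp only [Finset.mem_singleton] at hn
    simp [hn]

namespace IsCycleSeq

variable {θ h : ℕ → ℝ}

lemma summable_theta {C : ℝ} (H : IsCycleSeq θ h) (hC : ∀ j, θ j ≤ C) {r : ℝ} (hr0 : 0 ≤ r)
    (hr1 : r < 1) : Summable fun n => θ n * r ^ n := by
  refine Summable.of_nonneg_of_le (fun n => mul_nonneg (H.theta_nonneg n) (by positivity))
    (fun n => ?_) ((summable_geometric_of_lt_one hr0 hr1).mul_left C)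
  exact mul_le_mul_of_nonneg_right (hC n) (by positivity)

/-- The generating function of `h` is the exponential of `∑ θ j z ^ j / j`. -/
lemma tsum_eq_exp (H : IsCycleSeq θ h) {C : ℝ} (hC : ∀ j, θ j ≤ C) {z : ℝ} (hz0 : 0 ≤ z)
    (hz1 : z < 1) : ∑' n, h n * z ^ n = Real.exp (∑' j : ℕ, θ j / j * z ^ j) := by
  have sh : ∀ r : ℝ, 0 ≤ r → r < 1 → Summable fun n => |h n| * r ^ n := fun r h0 h1 => by
    simpa only [abs_of_nonneg (H.nonneg _)] using H.summable_mul_pow hC h0 h1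
  have sq : ∀ r : ℝ, 0 ≤ r → r < 1 → Summable fun n : ℕ => |θ n / n| * r ^ n := fun r h0 h1 => by
    refine Summable.of_nonneg_of_le (fun n => by positivity) (fun n => ?_)
      (H.summable_theta hC h0 h1)
    have hn : 0 ≤ θ n / n := div_nonneg (H.theta_nonneg n) (Nat.cast_nonneg n)
    rw [abs_of_nonneg hn]
    refine mul_le_mul_of_nonneg_right ?_ (by positivity)
    rcases n with _ | n
    · simp [H.theta_zero]
    · exact div_le_self (H.theta_nonneg _) (by push_cast; linarith [(Nat.cast_nonneg n : (0:ℝ) ≤ n)])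
  have hder : ∀ t ∈ Set.Icc 0 z, HasDerivAt
      (fun t : ℝ => (∑' n, h n * t ^ n) * Real.exp (-∑' j : ℕ, θ j / j * t ^ j)) 0 t := by
    intro t ht
    have ht1 : |t| < 1 := by rw [abs_of_nonneg ht.1]; exact lt_of_le_of_lt ht.2 hz1
    have ht2 : t < 1 := lt_of_le_of_lt ht.2 hz1
    have d1 := hasDerivAt_tsum_mul_pow sh ht1
    have d2 := hasDerivAt_tsum_mul_pow sq ht1
    have e2 : ∑' n : ℕ, ((n : ℝ) + 1) * (θ (n + 1) / ((n + 1 : ℕ) : ℝ)) * t ^ n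
        = ∑' n : ℕ, θ (n + 1) * t ^ n := by
      refine tsum_congr fun n => ?_
      push_cast
      field_simp
    have sθ : Summable fun n : ℕ => θ (n + 1) * t ^ n := by
      refine Summable.of_nonneg_of_le
        (fun n => mul_nonneg (H.theta_nonneg _) (pow_nonneg ht.1 n))
        (fun n => ?_) ((summable_geometric_of_lt_one ht.1 ht2).mul_left C)
      exact mul_le_mul_of_nonneg_right (hC _) (pow_nonneg ht.1 n)
    have sh' := H.summable_mul_pow hC ht.1 ht2
    have e1 : ∑' n : ℕ, ((n : ℝ) + 1) * h (n + 1) * t ^ n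
        = (∑' n : ℕ, θ (n + 1) * t ^ n) * ∑' n, h n * t ^ n := by
      rw [tsum_mul_tsum_eq_tsum_sum_antidiagonal_of_summable_norm sθ.norm sh'.norm]
      refine tsum_congr fun n => ?_
      rw [H.recurrence_succ, Finset.sum_mul]
      refine Finset.sum_congr rfl fun p hp => ?_
      rw [← Finset.HasAntidiagonal.mem_antidiagonal.1 hp, pow_add]
      ring
    rw [e1] at d1
    rw [e2] at d2
    refine (d1.mul d2.neg.exp).congr_deriv ?_
    simp only [Pi.neg_apply]
    ring
  have hconst := constant_of_has_deriv_right_zero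
    (fun t ht => (hder t ht).continuousAt.continuousWithinAt)
    (fun t ht => (hder t (Set.Ico_subset_Icc_self ht)).hasDerivWithinAt) z
    (Set.right_mem_Icc.2 hz0)
  have z1 : ∑' n, h n * (0 : ℝ) ^ n = 1 := by
    rw [tsum_eq_single 0 (fun n hn => by simp [hn])]
    simp [H.zero]
  have z2 : ∑' j : ℕ, θ j / j * (0 : ℝ) ^ j = 0 := by
    rw [tsum_eq_single 0 (fun n hn => by simp [hn])]
    simp
  simp only [z1, z2, neg_zero, Real.exp_zero, mul_one] at hconst
  rw [Real.exp_neg, ← div_eq_mul_inv, div_eq_one_iff_eq (Real.exp_pos _).ne'] at hconst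
  exact hconst

/-- First moment: `∑ n h n z ^ n = A G`. -/
lemma tsum_natCast_mul (H : IsCycleSeq θ h) {C : ℝ} (hC : ∀ j, θ j ≤ C) {z : ℝ} (hz0 : 0 ≤ z)
    (hz1 : z < 1) : ∑' n : ℕ, (n : ℝ) * (h n * z ^ n)
      = (∑' j, θ j * z ^ j) * ∑' n, h n * z ^ n := by
  rw [tsum_mul_tsum_eq_tsum_sum_antidiagonal_of_summable_norm
    (H.summable_theta hC hz0 hz1).norm (H.summable_mul_pow hC hz0 hz1).norm]
  refine tsum_congr fun n => ?_
  rw [← mul_assoc, H.recurrence, Finset.sum_mul]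
  refine Finset.sum_congr rfl fun p hp => ?_
  rw [← Finset.HasAntidiagonal.mem_antidiagonal.1 hp, pow_add]
  ring

/-- Second moment: `∑ n² h n z ^ n = (A² + B) G`. -/
lemma tsum_natCast_sq_mul (H : IsCycleSeq θ h) {C : ℝ} (hC : ∀ j, θ j ≤ C) {z : ℝ} (hz0 : 0 ≤ z)
    (hz1 : z < 1) : ∑' n : ℕ, (n : ℝ) ^ 2 * (h n * z ^ n)
      = ((∑' j, θ j * z ^ j) ^ 2 + ∑' j : ℕ, (j : ℝ) * (θ j * z ^ j)) * ∑' n, h n * z ^ n := by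
  have s1 := H.summable_theta hC hz0 hz1
  have s2 := H.summable_mul_pow hC hz0 hz1
  have s3 : Summable fun n : ℕ => (n : ℝ) * (θ n * z ^ n) := by
    simpa using summable_pow_mul_of_forall_summable
      (fun r h0 h1 => H.summable_theta hC h0 h1) 1 hz0 hz1
  have s4 : Summable fun n : ℕ => (n : ℝ) * (h n * z ^ n) := by
    simpa using summable_pow_mul_of_forall_summable
      (fun r h0 h1 => H.summable_mul_pow hC h0 h1) 1 hz0 hz1
  rw [add_mul, sq, mul_assoc, ← H.tsum_natCast_mul hC hz0 hz1,
    tsum_mul_tsum_eq_tsum_sum_antidiagonal_of_summable_norm s1.norm s4.norm,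
    tsum_mul_tsum_eq_tsum_sum_antidiagonal_of_summable_norm s3.norm s2.norm,
    ← (summable_norm_sum_mul_antidiagonal_of_summable_norm s1.norm s4.norm).of_norm.tsum_add
      (summable_norm_sum_mul_antidiagonal_of_summable_norm s3.norm s2.norm).of_norm]
  refine tsum_congr fun n => ?_
  rw [sq, mul_assoc, ← mul_assoc (n : ℝ) (h n), H.recurrence, Finset.sum_mul, Finset.mul_sum,
    ← Finset.sum_add_distrib]
  refine Finset.sum_congr rfl fun p hp => ?_
  rw [← Finset.HasAntidiagonal.mem_antidiagonal.1 hp, pow_add]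
  push_cast
  ring

end IsCycleSeq

/-! ### Sums over permutations -/

/-- The partition of `N` given by the cycle lengths of `π`, fixed points included. -/
def cyclePartition {N : ℕ} (π : Equiv.Perm (Fin N)) : N.Partition where
  parts := π.cycleType + Multiset.replicate (N - π.cycleType.sum) 1
  parts_pos {i} hi := by
    rcases Multiset.mem_add.1 hi with h | h
    · exact lt_trans zero_lt_one (Equiv.Perm.one_lt_of_mem_cycleType h)
    · rw [Multiset.eq_of_mem_replicate h]; exact one_pos
  parts_sum := by
    have := Equiv.Perm.sum_cycleType_le π
    rw [Fintype.card_fin] at this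
    simp only [Multiset.sum_add, Multiset.sum_replicate, smul_eq_mul, mul_one]
    omega

lemma count_one_cycleType {N : ℕ} (π : Equiv.Perm (Fin N)) : π.cycleType.count 1 = 0 :=
  Multiset.count_eq_zero.2 fun h => lt_irrefl _ (Equiv.Perm.one_lt_of_mem_cycleType h)

lemma cycCount_eq_count {N : ℕ} (π : Equiv.Perm (Fin N)) (j : ℕ) :
    cycCount π j = (cyclePartition π).parts.count j := by
  simp only [cycCount, cyclePartition, Multiset.count_add, Multiset.count_replicate]
  split_ifs with h1 h2 h2
  · subst h1; simp [count_one_cycleType]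
  · exact absurd h1.symm h2
  · exact absurd h2.symm h1
  · simp

lemma sum_mul_count_partition {N : ℕ} (p : N.Partition) :
    ∑ j ∈ Finset.Icc 1 N, j * p.parts.count j = N := by
  conv_rhs => rw [← p.parts_sum, Finset.sum_multiset_count]
  refine ((Finset.sum_subset (fun j hj => ?_) fun j _ hj => ?_).trans
    (Finset.sum_congr rfl fun j _ => mul_comm _ _)).symm
  · rw [Multiset.mem_toFinset] at hj
    exact Finset.mem_Icc.2 ⟨p.parts_pos hj, p.parts_sum ▸ Multiset.le_sum_of_mem hj⟩
  · rw [Multiset.mem_toFinset] at hj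
    simp [Multiset.count_eq_zero.2 hj]

lemma sum_mul_cycCount {N : ℕ} (π : Equiv.Perm (Fin N)) :
    ∑ j ∈ Finset.Icc 1 N, j * cycCount π j = N := by
  simp only [cycCount_eq_count]
  exact sum_mul_count_partition _

lemma cyclePartition_eq_iff {N : ℕ} (π : Equiv.Perm (Fin N)) (p : N.Partition) :
    cyclePartition π = p ↔ π.cycleType = p.parts.filter (2 ≤ ·) := by
  have hsplit : p.parts = p.parts.filter (2 ≤ ·) + Multiset.replicate (p.parts.count 1) 1 := by
    conv_lhs => rw [← Multiset.filter_add_not (2 ≤ ·) p.parts]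
    congr 1
    rw [← Multiset.filter_eq']
    refine Multiset.filter_congr fun x hx => ?_
    have := p.parts_pos hx
    omega
  constructor
  · rintro rfl
    simp only [cyclePartition, Multiset.filter_add]
    rw [Multiset.filter_eq_self.2 fun a ha => Equiv.Perm.two_le_of_mem_cycleType ha,
      Multiset.filter_eq_nil.2, add_zero]
    intro a ha
    rw [Multiset.eq_of_mem_replicate ha]
    norm_num
  · intro h
    ext1
    have hs := congrArg Multiset.sum hsplit
    rw [p.parts_sum, Multiset.sum_add, Multiset.sum_replicate, smul_eq_mul, mul_one] at hs
    conv_rhs => rw [hsplit]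
    simp only [cyclePartition, h]
    congr 2
    omega

lemma card_cyclePartition {N : ℕ} (p : N.Partition) :
    (Finset.univ.filter fun π : Equiv.Perm (Fin N) => cyclePartition π = p).card *
      ∏ j ∈ Finset.Icc 1 N, (j ^ p.parts.count j * (p.parts.count j).factorial) = N.factorial := by
  have hsub : p.parts.toFinset ⊆ Finset.Icc 1 N := fun j hj => by
    rw [Multiset.mem_toFinset] at hj
    exact Finset.mem_Icc.2 ⟨p.parts_pos hj, p.parts_sum ▸ Multiset.le_sum_of_mem hj⟩
  have hcount : ∀ n, 2 ≤ n → (p.parts.filter (2 ≤ ·)).count n = p.parts.count n := fun n hn =>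
    Multiset.count_filter_of_pos hn
  have hsum : (p.parts.filter (2 ≤ ·)).sum + p.parts.count 1 = N := by
    conv_rhs => rw [← p.parts_sum, ← Multiset.filter_add_not (2 ≤ ·) p.parts, Multiset.sum_add]
    congr 1
    have : p.parts.filter (fun x => ¬ 2 ≤ x) = Multiset.replicate (p.parts.count 1) 1 := by
      rw [← Multiset.filter_eq']
      refine Multiset.filter_congr fun x hx => ?_
      have := p.parts_pos hx
      omega
    rw [this]; simp
  have key := Equiv.Perm.card_of_cycleType_mul_eq (α := Fin N) (p.parts.filter (2 ≤ ·))
  rw [if_pos, Fintype.card_fin] at key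
  · simp only [cyclePartition_eq_iff]
    rw [← key]
    congr 1
    have h1 : ∏ j ∈ Finset.Icc 1 N, (j ^ p.parts.count j * (p.parts.count j).factorial)
        = ∏ j ∈ insert 1 p.parts.toFinset,
          (j ^ p.parts.count j * (p.parts.count j).factorial) := by
      refine Finset.prod_congr_of_eq_on_inter ?_ ?_ ?_
      · intro j _ hj
        rw [Finset.mem_insert, not_or, Multiset.mem_toFinset] at hj
        simp [Multiset.count_eq_zero.2 hj.2]
      · intro j hj hj'
        have : j ∉ p.parts := fun h => hj' (hsub (Multiset.mem_toFinset.2 h))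
        simp [Multiset.count_eq_zero.2 this]
      · intro j _ _; rfl
    have h2 : insert 1 p.parts.toFinset = insert 1 (p.parts.filter (2 ≤ ·)).toFinset := by
      ext x
      simp only [Finset.mem_insert, Multiset.mem_toFinset, Multiset.mem_filter]
      constructor
      · rintro (h | h)
        · exact Or.inl h
        · have := p.parts_pos h
          by_cases hx : x = 1
          · exact Or.inl hx
          · exact Or.inr ⟨h, by omega⟩
      · rintro (h | h)
        · exact Or.inl h
        · exact Or.inr h.1
    rw [h1, h2, Finset.prod_insert (by simp)]
    rw [Finset.prod_mul_distrib, one_pow, one_mul, Finset.prod_multiset_count, ← mul_assoc]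
    have h3 : N - (p.parts.filter (2 ≤ ·)).sum = p.parts.count 1 := by omega
    rw [h3]
    congr 1
    · congr 1
      refine Finset.prod_congr rfl fun x hx => ?_
      rw [hcount x (Multiset.of_mem_filter (Multiset.mem_toFinset.1 hx))]
    · refine Finset.prod_congr rfl fun x hx => ?_
      rw [hcount x (Multiset.of_mem_filter (Multiset.mem_toFinset.1 hx))]
  · rw [Fintype.card_fin]
    exact ⟨by omega, fun a ha => Multiset.of_mem_filter ha⟩

/-- The weight `∏ j, θ j ^ r_j(π)` of a permutation. -/
def cycWeight (θ : ℕ → ℝ) {N : ℕ} (π : Equiv.Perm (Fin N)) : ℝ :=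
  ∏ j ∈ Finset.Icc 1 N, θ j ^ cycCount π j

/-- The normalized partition function `(N!)⁻¹ ∑_π ∏ j, θ j ^ r_j(π)`. -/
def cycSum (θ : ℕ → ℝ) (N : ℕ) : ℝ :=
  (∑ π : Equiv.Perm (Fin N), cycWeight θ π) / N.factorial

lemma cycSum_eq_sum_partition (θ : ℕ → ℝ) (N : ℕ) :
    cycSum θ N = ∑ p : N.Partition, ∏ j ∈ Finset.Icc 1 N,
      ((θ j / j) ^ p.parts.count j / (p.parts.count j).factorial) := by
  have hN : (N.factorial : ℝ) ≠ 0 := by exact_mod_cast N.factorial_ne_zero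
  rw [cycSum, div_eq_iff hN, ← Finset.sum_fiberwise (s := Finset.univ) (g := cyclePartition),
    Finset.sum_mul]
  refine Finset.sum_congr rfl fun p _ => ?_
  have hc := card_cyclePartition p
  rw [Finset.sum_congr rfl (g := fun _ => ∏ j ∈ Finset.Icc 1 N, θ j ^ p.parts.count j)]
  · rw [Finset.sum_const, nsmul_eq_mul, ← hc]
    push_cast
    rw [mul_left_comm, ← Finset.prod_mul_distrib]
    congr 1
    refine Finset.prod_congr rfl fun j hj => ?_
    have hj0 : (j : ℝ) ≠ 0 := by
      have := (Finset.mem_Icc.1 hj).1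
      positivity
    have : ((p.parts.count j).factorial : ℝ) ≠ 0 := by
      exact_mod_cast Nat.factorial_ne_zero _
    rw [div_pow]
    field_simp
  · intro π hπ
    rw [← (Finset.mem_filter.1 hπ).2, cycWeight]
    simp only [cycCount_eq_count]

/-- Removing a part of size `j` from a partition. -/
lemma sum_partition_remove_part (θ : ℕ → ℝ) {N j : ℕ} (hj : j ∈ Finset.Icc 1 N) :
    ∑ p : N.Partition, ((j * p.parts.count j : ℕ) : ℝ) * ∏ i ∈ Finset.Icc 1 N,
      ((θ i / i) ^ p.parts.count i / (p.parts.count i).factorial)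
    = θ j * ∑ p : (N - j).Partition, ∏ i ∈ Finset.Icc 1 (N - j),
      ((θ i / i) ^ p.parts.count i / (p.parts.count i).factorial) := by
  obtain ⟨hj1, hjN⟩ := Finset.mem_Icc.1 hj
  have hj0 : (j : ℝ) ≠ 0 := by positivity
  rw [Finset.mul_sum, ← Finset.sum_filter_of_ne (p := fun p : N.Partition => j ∈ p.parts)]
  swap
  · intro p _ hp
    by_contra h
    simp [Multiset.count_eq_zero.2 h] at hp
  symm
  refine Finset.sum_bij (fun p _ => (⟨j ::ₘ p.parts, ?_, ?_⟩ : N.Partition)) ?_ ?_ ?_ ?_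
  · intro i hi
    rcases Multiset.mem_cons.1 hi with rfl | h
    · exact hj1
    · exact p.parts_pos h
  · rw [Multiset.sum_cons, p.parts_sum]; omega
  · intro p _
    simp
  · intro p _ q _ h
    ext1
    simpa [Nat.Partition.ext_iff] using h
  · intro q hq
    have hq' := (Finset.mem_filter.1 hq).2
    refine ⟨⟨q.parts.erase j, fun {i} hi => q.parts_pos (Multiset.mem_of_mem_erase hi), ?_⟩,
      Finset.mem_univ _, ?_⟩
    · have := Multiset.sum_erase hq'
      rw [q.parts_sum] at this
      omega
    · ext1
      exact Multiset.cons_erase hq'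
  · intro p _
    have hext : ∏ i ∈ Finset.Icc 1 (N - j),
        ((θ i / i) ^ p.parts.count i / (p.parts.count i).factorial)
        = ∏ i ∈ Finset.Icc 1 N, ((θ i / i) ^ p.parts.count i / (p.parts.count i).factorial) := by
      refine Finset.prod_subset (Finset.Icc_subset_Icc_right (Nat.sub_le _ _)) fun i hi hi' => ?_
      have : i ∉ p.parts := fun h => hi' (Finset.mem_Icc.2
        ⟨(Finset.mem_Icc.1 hi).1, (Multiset.le_sum_of_mem h).trans_eq p.parts_sum⟩)
      simp [Multiset.count_eq_zero.2 this]
    rw [hext, ← Finset.mul_prod_erase _ _ hj, ← Finset.mul_prod_erase _ _ hj]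
    have hrest : ∏ x ∈ (Finset.Icc 1 N).erase j, ((θ x / x) ^ (j ::ₘ p.parts).count x /
          ((j ::ₘ p.parts).count x).factorial)
        = ∏ x ∈ (Finset.Icc 1 N).erase j, ((θ x / x) ^ p.parts.count x /
          (p.parts.count x).factorial) := by
      refine Finset.prod_congr rfl fun x hx => ?_
      rw [Multiset.count_cons_of_ne (Finset.ne_of_mem_erase hx)]
    rw [hrest, Multiset.count_cons_self, ← mul_assoc, ← mul_assoc]
    congr 1
    have : ((p.parts.count j).factorial : ℝ) ≠ 0 := by
      exact_mod_cast Nat.factorial_ne_zero _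
    rw [Nat.factorial_succ, pow_succ]
    push_cast
    field_simp

theorem isCycleSeq_cycSum {θ : ℕ → ℝ} (h0 : θ 0 = 0) (hθ : ∀ j, 0 ≤ θ j) :
    IsCycleSeq θ (cycSum θ) where
  zero := by simp [cycSum, cycWeight]
  theta_zero := h0
  theta_nonneg := hθ
  recurrence N := by
    rw [Finset.Nat.sum_antidiagonal_eq_sum_range_succ_mk, Finset.sum_range_succ', h0, zero_mul,
      add_zero, Finset.range_eq_Ico, Finset.sum_Ico_add' (fun j => θ j * cycSum θ (N - j)) 0 N 1]
    have hI : Finset.Ico (0 + 1) (N + 1) = Finset.Icc 1 N := by ext; simp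
    rw [hI, cycSum_eq_sum_partition, Finset.mul_sum]
    calc ∑ p : N.Partition, (N : ℝ) * ∏ j ∈ Finset.Icc 1 N,
          ((θ j / j) ^ p.parts.count j / (p.parts.count j).factorial)
        = ∑ p : N.Partition, ∑ j ∈ Finset.Icc 1 N, ((j * p.parts.count j : ℕ) : ℝ) *
          ∏ i ∈ Finset.Icc 1 N,
            ((θ i / i) ^ p.parts.count i / (p.parts.count i).factorial) := by
          refine Finset.sum_congr rfl fun p _ => ?_
          rw [← Finset.sum_mul, ← Nat.cast_sum, sum_mul_count_partition]
      _ = _ := by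
          rw [Finset.sum_comm]
          refine Finset.sum_congr rfl fun j hj => ?_
          rw [sum_partition_remove_part θ hj, cycSum_eq_sum_partition]

/-! ### Bounds on partition functions at finite volume -/

namespace IsCycleSeq

variable {θ h : ℕ → ℝ}

lemma mul_pow_le_exp (H : IsCycleSeq θ h) {C : ℝ} (hC : ∀ j, θ j ≤ C) {z : ℝ} (hz0 : 0 ≤ z)
    (hz1 : z < 1) (N : ℕ) : h N * z ^ N ≤ Real.exp (∑' j : ℕ, θ j / j * z ^ j) := by
  rw [← H.tsum_eq_exp hC hz0 hz1]
  exact (H.summable_mul_pow hC hz0 hz1).le_tsum N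
    fun n _ => mul_nonneg (H.nonneg n) (by positivity)

lemma mul_le_of_le (H : IsCycleSeq θ h) {c : ℝ} (hc : ∀ j, 1 ≤ j → c ≤ θ j) (hc1 : c ≤ 1)
    {n N : ℕ} (hn : n ≤ N) : c * h n ≤ (N + 1) * h N := by
  have hN := H.nonneg N
  have hn0 := H.nonneg n
  rcases hn.eq_or_lt with rfl | hlt
  · refine mul_le_mul_of_nonneg_right ?_ hn0
    linarith [(Nat.cast_nonneg n : (0 : ℝ) ≤ n)]
  · have h1 : θ (N - n) * h n ≤ (N : ℝ) * h N := by
      rw [H.recurrence]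
      exact Finset.single_le_sum (f := fun p : ℕ × ℕ => θ p.1 * h p.2)
        (fun p _ => mul_nonneg (H.theta_nonneg _) (H.nonneg _))
        (Finset.HasAntidiagonal.mem_antidiagonal.2 (by simp; omega) : (N - n, n) ∈ _)
    have h2 := mul_le_mul_of_nonneg_right (hc (N - n) (by omega)) hn0
    linarith

/-- Lower bound on `h N` through the second moment method. -/
lemma exp_le_mul_rpow (H : IsCycleSeq θ h) {C : ℝ} (hC : ∀ j, θ j ≤ C) {c : ℝ} (hc0 : 0 < c)
    (hc1 : c ≤ 1) (hc : ∀ j, 1 ≤ j → c ≤ θ j) {z : ℝ} (hz0 : 0 < z) (hz1 : z < 1) {N : ℕ}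
    {D u : ℝ} (hu : 0 < u) (h1 : ∑' j, θ j * z ^ j + u ≤ N)
    (h2 : (N : ℝ) - D ≤ ∑' j, θ j * z ^ j - u)
    (h3 : 2 * ∑' j : ℕ, (j : ℝ) * (θ j * z ^ j) ≤ u ^ 2) :
    Real.exp (∑' j : ℕ, θ j / j * z ^ j) ≤
      2 * (N + 1) ^ 2 / c * (h N * z ^ ((N : ℝ) - D)) := by
  have G0 := (H.summable_mul_pow hC hz0.le hz1).hasSum
  have s1 := (summable_pow_mul_of_forall_summable
    (fun r a b => H.summable_mul_pow hC a b) 1 hz0.le hz1).hasSum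
  have s2 := (summable_pow_mul_of_forall_summable
    (fun r a b => H.summable_mul_pow hC a b) 2 hz0.le hz1).hasSum
  rw [H.tsum_natCast_sq_mul hC hz0.le hz1] at s2
  simp only [pow_one] at s1
  rw [H.tsum_natCast_mul hC hz0.le hz1] at s1
  set A := ∑' j, θ j * z ^ j
  set B := ∑' j : ℕ, (j : ℝ) * (θ j * z ^ j)
  set G := ∑' n, h n * z ^ n with hG
  rw [← H.tsum_eq_exp hC hz0.le hz1, ← hG]
  have hG0 : 0 ≤ G := tsum_nonneg fun n => mul_nonneg (H.nonneg n) (by positivity)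
  have hNn : (0 : ℝ) ≤ N := Nat.cast_nonneg N
  set M := (N + 1) / c * (h N * z ^ ((N : ℝ) - D)) with hM
  have hM0 : 0 ≤ M := by
    have := H.nonneg N
    positivity
  have hf : HasSum (fun n : ℕ => (1 - ((n : ℝ) - A) ^ 2 / u ^ 2) * (h n * z ^ n))
      (G * (1 - B / u ^ 2)) := by
    have := ((G0.mul_left (1 - A ^ 2 / u ^ 2)).add (s1.mul_left (2 * A / u ^ 2))).sub
      (s2.div_const (u ^ 2))
    have e1 : (1 - A ^ 2 / u ^ 2) * G + 2 * A / u ^ 2 * (A * G) - (A ^ 2 + B) * G / u ^ 2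
        = G * (1 - B / u ^ 2) := by ring
    rw [e1] at this
    convert! this using 2 with n
    ring
  have hg : HasSum (fun n : ℕ => if n ∈ Finset.range (N + 1) then M else 0)
      (∑ n ∈ Finset.range (N + 1), if n ∈ Finset.range (N + 1) then M else 0) :=
    hasSum_sum_of_ne_finset_zero fun n hn => if_neg hn
  have hle : ∀ n : ℕ, (1 - ((n : ℝ) - A) ^ 2 / u ^ 2) * (h n * z ^ n)
      ≤ if n ∈ Finset.range (N + 1) then M else 0 := by
    intro n
    have hterm : 0 ≤ h n * z ^ n := mul_nonneg (H.nonneg n) (by positivity)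
    by_cases hfar : u ≤ |(n : ℝ) - A|
    · refine le_trans (mul_nonpos_of_nonpos_of_nonneg ?_ hterm) ?_
      · rw [sub_nonpos, one_le_div (by positivity), ← sq_abs ((n : ℝ) - A)]
        exact pow_le_pow_left₀ hu.le hfar 2
      · split_ifs
        exacts [hM0, le_rfl]
    · push Not at hfar
      obtain ⟨ha, hb⟩ := abs_lt.1 hfar
      have hnN : n ≤ N := by
        have : (n : ℝ) < N + 1 := by linarith
        exact_mod_cast Nat.lt_succ_iff.1 (by exact_mod_cast this)
      rw [if_pos (Finset.mem_range.2 (Nat.lt_succ_of_le hnN))]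
      calc (1 - ((n : ℝ) - A) ^ 2 / u ^ 2) * (h n * z ^ n)
          ≤ 1 * (h n * z ^ n) := by
            refine mul_le_mul_of_nonneg_right ?_ hterm
            have : 0 ≤ ((n : ℝ) - A) ^ 2 / u ^ 2 := by positivity
            linarith
        _ ≤ ((N + 1) / c * h N) * z ^ ((N : ℝ) - D) := by
            rw [one_mul]
            refine mul_le_mul ?_ ?_ (by positivity) ?_
            · rw [div_mul_eq_mul_div, le_div_iff₀ hc0, mul_comm (h n)]
              exact H.mul_le_of_le hc hc1 hnN
            · rw [← Real.rpow_natCast]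
              exact Real.rpow_le_rpow_of_exponent_ge hz0 hz1.le (by linarith)
            · have := H.nonneg N
              positivity
        _ = M := by rw [hM]; ring
  have key := hasSum_le hle hf hg
  rw [Finset.sum_congr rfl fun n hn => if_pos hn, Finset.sum_const, Finset.card_range,
    nsmul_eq_mul] at key
  have hB : B / u ^ 2 ≤ 1 / 2 := by
    rw [div_le_iff₀ (by positivity)]
    linarith
  have : G * (1 / 2) ≤ G * (1 - B / u ^ 2) := mul_le_mul_of_nonneg_left (by linarith) hG0
  push_cast at key
  rw [hM] at key
  have e : 2 * ((N : ℝ) + 1) ^ 2 / c * (h N * z ^ ((N : ℝ) - D))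
      = 2 * (((N : ℝ) + 1) * ((N + 1) / c * (h N * z ^ ((N : ℝ) - D)))) := by ring
  rw [e]
  linarith

end IsCycleSeq

/-- The mean number of points in cycles of length at most `K` under the cycle weights `θ`. -/
def meanShort (θ : ℕ → ℝ) (N K : ℕ) : ℝ :=
  (∑ π : Equiv.Perm (Fin N), cycWeight θ π * ∑ j ∈ Finset.Icc 1 K, (j : ℝ) * cycCount π j) /
    ∑ π : Equiv.Perm (Fin N), cycWeight θ π

/-- Jensen's inequality for the exponential function and a finite weighted mean. -/
lemma exp_mean_le {ι : Type*} [Fintype ι] {w X : ι → ℝ} (hw : ∀ i, 0 ≤ w i)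
    (hw0 : 0 < ∑ i, w i) (s : ℝ) :
    Real.exp (s * ((∑ i, w i * X i) / ∑ i, w i)) * ∑ i, w i ≤ ∑ i, w i * Real.exp (s * X i) := by
  set E := (∑ i, w i * X i) / ∑ i, w i with hE
  have hE' : ∑ i, w i * X i = E * ∑ i, w i := by rw [hE]; field_simp
  have h1 : ∀ i, w i * (Real.exp (s * E) * (1 + (s * X i - s * E))) ≤
      w i * Real.exp (s * X i) := fun i => by
    refine mul_le_mul_of_nonneg_left ?_ (hw i)
    have h2 := Real.add_one_le_exp (s * X i - s * E)
    calc Real.exp (s * E) * (1 + (s * X i - s * E))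
        ≤ Real.exp (s * E) * Real.exp (s * X i - s * E) :=
          mul_le_mul_of_nonneg_left (by linarith) (Real.exp_pos _).le
      _ = _ := by rw [← Real.exp_add]; congr 1; ring
  refine le_trans (le_of_eq ?_) (Finset.sum_le_sum fun i _ => h1 i)
  have : ∀ i, w i * (Real.exp (s * E) * (1 + (s * X i - s * E)))
      = Real.exp (s * E) * (1 - s * E) * w i + Real.exp (s * E) * s * (w i * X i) :=
    fun i => by ring
  rw [Finset.sum_congr rfl fun i _ => this i, Finset.sum_add_distrib, ← Finset.mul_sum,
    ← Finset.mul_sum, hE']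
  ring

/-- The cycle weights tilted by `exp (s j)` for `j ≤ K`. -/
def tilt (θ : ℕ → ℝ) (s : ℝ) (K j : ℕ) : ℝ :=
  θ j * if j ∈ Finset.Icc 1 K then Real.exp (s * j) else 1

lemma cycWeight_tilt (θ : ℕ → ℝ) (s : ℝ) {K N : ℕ} (hK : K ≤ N) (π : Equiv.Perm (Fin N)) :
    cycWeight (tilt θ s K) π =
      cycWeight θ π * Real.exp (s * ∑ j ∈ Finset.Icc 1 K, (j : ℝ) * cycCount π j) := by
  simp only [cycWeight, tilt, mul_pow, Finset.prod_mul_distrib]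
  congr 1
  rw [Finset.mul_sum, Real.exp_sum,
    ← Finset.prod_subset (Finset.Icc_subset_Icc_right hK) fun j _ hj => by simp [hj]]
  refine Finset.prod_congr rfl fun j hj => ?_
  rw [if_pos hj, ← Real.exp_nat_mul]
  congr 1
  ring

/-- The main finite-volume estimate on the mean number of points in short cycles. -/
lemma mul_meanShort_le {θ : ℕ → ℝ} {C c : ℝ} (h0 : θ 0 = 0) (hc0 : 0 < c)
    (hc1 : c ≤ 1) (hc : ∀ j, 1 ≤ j → c ≤ θ j) (hC : ∀ j, θ j ≤ C) {z : ℝ}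
    (hz0 : 0 < z) (hz1 : z < 1) {K N : ℕ} (hK : K ≤ N) {D u : ℝ} (hu : 0 < u)
    (h1 : ∑' j, θ j * z ^ j + u ≤ N) (h2 : (N : ℝ) - D ≤ ∑' j, θ j * z ^ j - u)
    (h3 : 2 * ∑' j : ℕ, (j : ℝ) * (θ j * z ^ j) ≤ u ^ 2) (s : ℝ) :
    s * meanShort θ N K ≤ ∑ j ∈ Finset.Icc 1 K, θ j * ((Real.exp (s * j) - 1) / j * z ^ j)
      + D * (-Real.log z) + Real.log (2 * (N + 1) ^ 2 / c) := by
  have hθ : ∀ j, 0 ≤ θ j := fun j => by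
    rcases j with _ | j
    · exact h0.ge
    · exact hc0.le.trans (hc _ (by omega))
  have H := isCycleSeq_cycSum h0 hθ
  have Hs : IsCycleSeq (tilt θ s K) (cycSum (tilt θ s K)) :=
    isCycleSeq_cycSum (by simp [tilt, h0]) fun j => mul_nonneg (hθ j) (by split_ifs <;> positivity)
  have htb : ∀ j, tilt θ s K j ≤ C * Real.exp (|s| * K) := fun j => by
    refine mul_le_mul (hC j) ?_ (by split_ifs <;> positivity) ((hθ j).trans (hC j))
    split_ifs with hj
    · refine Real.exp_le_exp.2 ?_
      have hjK : (j : ℝ) ≤ K := by exact_mod_cast (Finset.mem_Icc.1 hj).2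
      calc s * j ≤ |s| * j := mul_le_mul_of_nonneg_right (le_abs_self s) (Nat.cast_nonneg j)
        _ ≤ |s| * K := mul_le_mul_of_nonneg_left hjK (abs_nonneg s)
    · exact Real.one_le_exp (by positivity)
  have hNf : (0 : ℝ) < N.factorial := by exact_mod_cast N.factorial_pos
  have hlow := H.exp_le_mul_rpow hC hc0 hc1 hc hz0 hz1 hu h1 h2 h3
  have hup := Hs.mul_pow_le_exp htb hz0.le hz1 N
  have hNn : (0 : ℝ) ≤ N := Nat.cast_nonneg N
  have hzD : 0 < z ^ ((N : ℝ) - D) := Real.rpow_pos_of_pos hz0 _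
  have hhN : 0 < cycSum θ N := by
    refine lt_of_le_of_ne (H.nonneg N) fun h => ?_
    rw [← h, zero_mul, mul_zero] at hlow
    exact (Real.exp_pos _).not_ge hlow
  have hW : ∑ π : Equiv.Perm (Fin N), cycWeight θ π = cycSum θ N * N.factorial := by
    rw [cycSum]; field_simp
  have hWs : ∑ π : Equiv.Perm (Fin N), cycWeight θ π *
      Real.exp (s * ∑ j ∈ Finset.Icc 1 K, (j : ℝ) * cycCount π j)
      = cycSum (tilt θ s K) N * N.factorial := by
    rw [cycSum, div_mul_cancel₀ _ hNf.ne']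
    exact Finset.sum_congr rfl fun π _ => (cycWeight_tilt θ s hK π).symm
  have hJ : Real.exp (s * meanShort θ N K) * ∑ π : Equiv.Perm (Fin N), cycWeight θ π
      ≤ ∑ π : Equiv.Perm (Fin N), cycWeight θ π *
        Real.exp (s * ∑ j ∈ Finset.Icc 1 K, (j : ℝ) * cycCount π j) := exp_mean_le
    (w := fun π : Equiv.Perm (Fin N) => cycWeight θ π)
    (X := fun π => ∑ j ∈ Finset.Icc 1 K, (j : ℝ) * cycCount π j)
    (fun π => Finset.prod_nonneg fun j _ => pow_nonneg (hθ j) _)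
    (by rw [hW]; positivity) s
  rw [hWs, hW, ← mul_assoc] at hJ
  have hJ' := le_of_mul_le_mul_right hJ hNf
  have hQ : ∑' j : ℕ, tilt θ s K j / j * z ^ j = ∑' j : ℕ, θ j / j * z ^ j +
      ∑ j ∈ Finset.Icc 1 K, θ j * ((Real.exp (s * j) - 1) / j * z ^ j) := by
    have sq : Summable fun j : ℕ => θ j / j * z ^ j := by
      refine Summable.of_nonneg_of_le
        (fun n => mul_nonneg (div_nonneg (hθ n) (Nat.cast_nonneg n)) (by positivity))
        (fun n => ?_) (H.summable_theta hC hz0.le hz1)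
      refine mul_le_mul_of_nonneg_right ?_ (by positivity)
      rcases n with _ | n
      · simp [h0]
      · exact div_le_self (hθ _) (by push_cast; linarith [(Nat.cast_nonneg n : (0 : ℝ) ≤ n)])
    have hfin : HasSum (fun j : ℕ => if j ∈ Finset.Icc 1 K then
        θ j * ((Real.exp (s * j) - 1) / j * z ^ j) else 0)
        (∑ j ∈ Finset.Icc 1 K, θ j * ((Real.exp (s * j) - 1) / j * z ^ j)) := by
      rw [← Finset.sum_congr rfl fun j hj => if_pos hj]
      exact hasSum_sum_of_ne_finset_zero fun j hj => if_neg hj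
    rw [← (sq.hasSum.add hfin).tsum_eq]
    refine tsum_congr fun j => ?_
    rw [tilt]
    split_ifs with hj
    · ring
    · ring
  have hlog := Real.log_le_log (by positivity) hJ'
  rw [Real.log_mul (Real.exp_pos _).ne' hhN.ne', Real.log_exp] at hlog
  have hspos : 0 < cycSum (tilt θ s K) N := lt_of_lt_of_le (by positivity) hJ'
  have hup' := Real.log_le_log (by positivity) hup
  rw [Real.log_exp, hQ, Real.log_mul hspos.ne' (by positivity), Real.log_pow] at hup'
  have hlow' := Real.log_le_log (Real.exp_pos _) hlow
  rw [Real.log_exp, Real.log_mul (by positivity) (by positivity),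
    Real.log_mul hhN.ne' hzD.ne', Real.log_rpow hz0] at hlow'
  linarith

/-! ### The thermodynamic limit -/

/-- A sequence whose multiples by `s` are asymptotically bounded by `φ s`, where `φ 0 = 0`,
converges to the derivative of `φ` at zero. -/
lemma tendsto_of_forall_mul_le {y : ℕ → ℝ} {φ : ℝ → ℝ} {x : ℝ} (h0 : φ 0 = 0)
    (hφ : HasDerivAt φ x 0)
    (hy : ∀ s κ : ℝ, 0 < κ → ∀ᶠ m in atTop, s * y m ≤ φ s + κ) : Tendsto y atTop (𝓝 x) := by
  have hsl := hasDerivAt_iff_tendsto_slope_zero.1 hφ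
  simp only [zero_add, h0, sub_zero, smul_eq_mul] at hsl
  refine tendsto_order.2 ⟨fun a ha => ?_, fun a ha => ?_⟩
  · have h1 : ∀ᶠ s in 𝓝[<] (0 : ℝ), (a + x) / 2 < s⁻¹ * φ s :=
      (hsl.mono_left (nhdsWithin_mono _ fun s hs => ne_of_lt hs)).eventually_const_lt (by linarith)
    obtain ⟨s, hs, hs0⟩ := (h1.and self_mem_nhdsWithin).exists
    have hs0 : s < 0 := hs0
    rw [inv_mul_eq_div, lt_div_iff_of_neg hs0] at hs
    filter_upwards [hy s (-s * (x - a) / 4) (by nlinarith)] with m hm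
    nlinarith
  · have h1 : ∀ᶠ s in 𝓝[>] (0 : ℝ), s⁻¹ * φ s < (a + x) / 2 :=
      (hsl.mono_left (nhdsWithin_mono _ fun s hs => ne_of_gt hs)).eventually_lt_const (by linarith)
    obtain ⟨s, hs, hs0⟩ := (h1.and self_mem_nhdsWithin).exists
    have hs0 : 0 < s := hs0
    rw [inv_mul_eq_div, div_lt_iff₀ hs0] at hs
    filter_upwards [hy s (s * (a - x) / 4) (by nlinarith)] with m hm
    nlinarith

section PowerSeries

variable {q : ℕ → ℝ}

lemma continuousOn_tsum_mul_pow (hq : ∀ j, 0 ≤ q j) (hs : Summable q) :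
    ContinuousOn (fun z : ℝ => ∑' j, q j * z ^ j) (Set.Icc 0 1) := by
  refine continuousOn_tsum (u := q) (fun j => by fun_prop) hs fun j z hz => ?_
  rw [Real.norm_of_nonneg (mul_nonneg (hq j) (pow_nonneg hz.1 j))]
  exact mul_le_of_le_one_right (hq j) (pow_le_one₀ hz.1 hz.2)

lemma summable_mul_pow_of_le_one (hq : ∀ j, 0 ≤ q j) (hs : Summable q) {z : ℝ} (hz0 : 0 ≤ z)
    (hz1 : z ≤ 1) : Summable fun j => q j * z ^ j :=
  Summable.of_nonneg_of_le (fun j => mul_nonneg (hq j) (pow_nonneg hz0 j))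
    (fun j => mul_le_of_le_one_right (hq j) (pow_le_one₀ hz0 hz1)) hs

lemma tsum_mul_pow_lt (hq : ∀ j, 0 ≤ q j) (hq1 : 0 < q 1) (hs : Summable q) {y z : ℝ}
    (hy : 0 ≤ y) (hyz : y < z) (hz : z ≤ 1) : ∑' j, q j * y ^ j < ∑' j, q j * z ^ j := by
  refine Summable.tsum_lt_tsum (i := 1) (fun j => ?_) ?_
    (summable_mul_pow_of_le_one hq hs hy (hyz.le.trans hz))
    (summable_mul_pow_of_le_one hq hs (hy.trans hyz.le) hz)
  · exact mul_le_mul_of_nonneg_left (pow_le_pow_left₀ hy hyz.le j) (hq j)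
  · simpa using mul_lt_mul_of_pos_left hyz hq1

/-- The fugacity at density `ρ`. -/
lemma exists_fugacity (hq : ∀ j, 0 ≤ q j) (hq0 : q 0 = 0) (hs : Summable q) {ρ : ℝ} (hρ : 0 < ρ) :
    ∃ z : ℝ, 0 < z ∧ z ≤ 1 ∧ ∑' j, q j * z ^ j = min ρ (∑' j, q j) ∧
      (ρ - ∑' j, q j * z ^ j) * Real.log z = 0 := by
  rcases lt_or_ge ρ (∑' j, q j) with h | h
  · have h0 : ∑' j, q j * (0 : ℝ) ^ j = 0 := by
      rw [tsum_eq_single 0 (fun n hn => by simp [hn])]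
      simp [hq0]
    have h1 : ∑' j, q j * (1 : ℝ) ^ j = ∑' j, q j := by simp
    obtain ⟨z, hz, hzρ⟩ := intermediate_value_Icc zero_le_one (continuousOn_tsum_mul_pow hq hs)
      (show ρ ∈ Set.Icc _ _ from ⟨by simp only [h0]; exact hρ.le, by simp only [h1]; exact h.le⟩)
    simp only at hzρ
    refine ⟨z, lt_of_le_of_ne hz.1 ?_, hz.2, ?_, ?_⟩
    · rintro rfl
      rw [h0] at hzρ
      exact hρ.ne hzρ
    · rw [hzρ, min_eq_left h.le]
    · rw [hzρ, sub_self, zero_mul]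
  · exact ⟨1, one_pos, le_rfl, by simp [min_eq_right h], by simp⟩

end PowerSeries

/-- A family of cycle weights `θ m` in volumes `V m → ∞` whose densities `θ m j / V m` converge
to a summable sequence `q`. -/
structure IsThermo (V : ℕ → ℝ) (θ : ℕ → ℕ → ℝ) (q : ℕ → ℝ) (c C : ℝ) : Prop where
  volume_tendsto : Tendsto V atTop atTop
  theta_zero : ∀ m, θ m 0 = 0
  c_pos : 0 < c
  c_le_one : c ≤ 1
  le_theta : ∀ᶠ m in atTop, ∀ j, 1 ≤ j → c ≤ θ m j
  theta_le : ∀ᶠ m in atTop, ∀ j, θ m j ≤ C * V m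
  tendsto_div : ∀ j, Tendsto (fun m => θ m j / V m) atTop (𝓝 (q j))
  q_one_pos : 0 < q 1
  q_summable : Summable q

namespace IsThermo

variable {V : ℕ → ℝ} {θ : ℕ → ℕ → ℝ} {q : ℕ → ℝ} {c C : ℝ}

lemma theta_nonneg (T : IsThermo V θ q c C) : ∀ᶠ m in atTop, ∀ j, 0 ≤ θ m j := by
  filter_upwards [T.le_theta] with m hm j
  rcases j with _ | j
  · exact (T.theta_zero m).ge
  · exact T.c_pos.le.trans (hm _ (by omega))

lemma q_nonneg (T : IsThermo V θ q c C) (j : ℕ) : 0 ≤ q j := by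
  refine ge_of_tendsto (T.tendsto_div j) ?_
  filter_upwards [T.theta_nonneg, T.volume_tendsto.eventually_gt_atTop 0] with m hm hV
  exact div_nonneg (hm j) hV.le

lemma q_zero (T : IsThermo V θ q c C) : q 0 = 0 :=
  tendsto_nhds_unique (T.tendsto_div 0) (by simp [T.theta_zero])

lemma tendsto_tsum_div (T : IsThermo V θ q c C) {z : ℝ} (hz0 : 0 ≤ z) (hz1 : z < 1) :
    Tendsto (fun m => (∑' j, θ m j * z ^ j) / V m) atTop (𝓝 (∑' j, q j * z ^ j)) := by
  simp only [← tsum_div_const]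
  refine tendsto_tsum_of_dominated_convergence (bound := fun j => C * z ^ j)
    ((summable_geometric_of_lt_one hz0 hz1).mul_left C) (fun j => ?_) ?_
  · simpa only [div_mul_eq_mul_div] using (T.tendsto_div j).mul_const (z ^ j)
  · filter_upwards [T.theta_nonneg, T.theta_le, T.volume_tendsto.eventually_gt_atTop 0]
      with m h0 h1 hV j
    rw [Real.norm_of_nonneg (div_nonneg (mul_nonneg (h0 j) (by positivity)) hV.le),
      div_le_iff₀ hV]
    calc θ m j * z ^ j ≤ C * V m * z ^ j := mul_le_mul_of_nonneg_right (h1 j) (by positivity)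
      _ = _ := by ring

lemma tsum_natCast_mul_le (T : IsThermo V θ q c C) {z : ℝ} (hz0 : 0 ≤ z) (hz1 : z < 1) :
    ∀ᶠ m in atTop, ∑' j : ℕ, (j : ℝ) * (θ m j * z ^ j)
      ≤ V m * (C * ∑' j : ℕ, (j : ℝ) * z ^ j) := by
  have hs : Summable fun j : ℕ => (j : ℝ) * z ^ j := by
    simpa using summable_pow_mul_geometric_of_norm_lt_one 1 (r := z)
      (by rwa [Real.norm_of_nonneg hz0])
  filter_upwards [T.theta_nonneg, T.theta_le] with m h0 h1
  rw [← tsum_mul_left, ← tsum_mul_left]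
  have hle : ∀ j : ℕ, (j : ℝ) * (θ m j * z ^ j) ≤ V m * (C * ((j : ℝ) * z ^ j)) := fun j => by
    have : θ m j * ((j : ℝ) * z ^ j) ≤ C * V m * ((j : ℝ) * z ^ j) :=
      mul_le_mul_of_nonneg_right (h1 j) (by positivity)
    linarith
  have hs' : Summable fun j : ℕ => V m * (C * ((j : ℝ) * z ^ j)) := (hs.mul_left C).mul_left _
  refine Summable.tsum_le_tsum hle (Summable.of_nonneg_of_le (fun j => ?_) hle hs') hs'
  have := h0 j
  positivity

lemma tendsto_log_div (T : IsThermo V θ q c C) {ρ : ℝ} (hρ : 0 < ρ) :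
    Tendsto (fun m => Real.log (2 * (ρ * V m + 1) ^ 2 / c) / V m) atTop (𝓝 0) := by
  have hV := T.volume_tendsto
  have hy : Tendsto (fun m => ρ * V m + 1) atTop atTop :=
    tendsto_atTop_add_const_right _ _ (hV.const_mul_atTop hρ)
  have h1 : Tendsto (fun m => Real.log (ρ * V m + 1) / (ρ * V m + 1)) atTop (𝓝 0) :=
    (Real.isLittleO_log_id_atTop.tendsto_div_nhds_zero).comp hy
  have h2 : Tendsto (fun m => (ρ * V m + 1) / V m) atTop (𝓝 ρ) := by
    have : Tendsto (fun m => ρ + (V m)⁻¹) atTop (𝓝 (ρ + 0)) :=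
      tendsto_const_nhds.add hV.inv_tendsto_atTop
    rw [add_zero] at this
    refine this.congr' ?_
    filter_upwards [hV.eventually_gt_atTop 0] with m hm
    field_simp
  have h3 : Tendsto (fun m => Real.log (2 / c) * (V m)⁻¹) atTop (𝓝 (Real.log (2 / c) * 0)) :=
    hV.inv_tendsto_atTop.const_mul _
  have h4 := h3.add ((h1.mul h2).const_mul 2)
  simp only [mul_zero, zero_mul, add_zero] at h4
  refine h4.congr' ?_
  have hc := T.c_pos
  filter_upwards [hV.eventually_gt_atTop 0] with m hm
  have hpos : 0 < ρ * V m + 1 := by positivity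
  rw [show 2 * (ρ * V m + 1) ^ 2 / c = 2 / c * (ρ * V m + 1) ^ 2 by ring,
    Real.log_mul (by positivity) (by positivity), Real.log_pow]
  push_cast
  field_simp

lemma eventually_mul_meanShort_le (T : IsThermo V θ q c C) {ρ : ℝ} (hρ : 0 < ρ) {N : ℕ → ℕ}
    (hN : ∀ m, (N m : ℝ) = ρ * V m) {z₀ : ℝ} (hz0 : 0 < z₀) (hz1 : z₀ ≤ 1)
    (hle : ∑' j, q j * z₀ ^ j ≤ ρ)
    (hlog : (ρ - ∑' j, q j * z₀ ^ j) * Real.log z₀ = 0) (K : ℕ) (s κ : ℝ) (hκ : 0 < κ) :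
    ∀ᶠ m in atTop, s * (meanShort (θ m) (N m) K / V m) ≤
      ∑ j ∈ Finset.Icc 1 K, q j * ((Real.exp (s * j) - 1) / j * z₀ ^ j) + κ := by
  set R := fun z : ℝ => ∑' j, q j * z ^ j with hR
  set Φ := fun z : ℝ => ∑ j ∈ Finset.Icc 1 K, q j * ((Real.exp (s * j) - 1) / j * z ^ j) with hΦ
  have hF : Tendsto (fun z => Φ z + (ρ - R z) * (-Real.log z)) (𝓝[<] z₀) (𝓝 (Φ z₀)) := by
    have e : Φ z₀ = Φ z₀ + (ρ - R z₀) * (-Real.log z₀) := by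
      rw [mul_neg, hlog, neg_zero, add_zero]
    rw [e]
    refine Tendsto.add ?_ (Tendsto.mul (tendsto_const_nhds.sub ?_) (Tendsto.neg ?_))
    · exact (Continuous.tendsto (by fun_prop) z₀).mono_left nhdsWithin_le_nhds
    · have h1 := (continuousOn_tsum_mul_pow T.q_nonneg T.q_summable) z₀ ⟨hz0.le, hz1⟩
      refine h1.mono_left (nhdsWithin_le_of_mem ?_)
      filter_upwards [Ioo_mem_nhdsLT hz0] with x hx
      exact ⟨hx.1.le, hx.2.le.trans hz1⟩
    · exact (Real.continuousAt_log hz0.ne').mono_left nhdsWithin_le_nhds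
  obtain ⟨z, hzF, hzp, hzlt⟩ := ((hF.eventually_lt_const
    (show Φ z₀ < Φ z₀ + κ / 4 by linarith)).and (Ioo_mem_nhdsLT hz0)).exists
  have hz1' : z < 1 := hzlt.trans_le hz1
  have hRz : R z < ρ :=
    (tsum_mul_pow_lt T.q_nonneg T.q_one_pos T.q_summable hzp.le hzlt hz1).trans_le hle
  have hlz : 0 < -Real.log z := by
    have := Real.log_neg hzp hz1'
    linarith
  set δ := κ / 4 / (-Real.log z) with hδ
  have hδ0 : 0 < δ := by positivity
  have hδz : δ * (-Real.log z) = κ / 4 := by rw [hδ]; exact div_mul_cancel₀ _ hlz.ne'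
  set τ := min (ρ - R z) δ / 2 with hτ
  have hτ0 : 0 < τ := by
    have : 0 < min (ρ - R z) δ := lt_min (by linarith) hδ0
    positivity
  have hτ1 : 2 * τ ≤ ρ - R z := by rw [hτ]; linarith [min_le_left (ρ - R z) δ]
  have hτ2 : 2 * τ ≤ δ := by rw [hτ]; linarith [min_le_right (ρ - R z) δ]
  have hA := (Metric.tendsto_nhds.1 (T.tendsto_tsum_div hzp.le hz1')) τ hτ0
  have hΦlim : Tendsto (fun m => ∑ j ∈ Finset.Icc 1 K,
      θ m j / V m * ((Real.exp (s * j) - 1) / j * z ^ j)) atTop (𝓝 (Φ z)) :=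
    tendsto_finsetSum _ fun j _ => (T.tendsto_div j).mul_const _
  have hNtop : Tendsto (fun m => (N m : ℝ)) atTop atTop := by
    simp only [hN]
    exact T.volume_tendsto.const_mul_atTop hρ
  set b := C * ∑' j : ℕ, (j : ℝ) * z ^ j
  filter_upwards [hA, hΦlim.eventually_lt_const (show Φ z < Φ z + κ / 4 by linarith),
    (T.tendsto_log_div hρ).eventually_lt_const (show 0 < κ / 4 by positivity),
    T.le_theta, T.theta_le, T.volume_tendsto.eventually_gt_atTop 0,
    T.volume_tendsto.eventually_ge_atTop (2 * b / τ ^ 2),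
    T.tsum_natCast_mul_le hzp.le hz1', hNtop.eventually_ge_atTop (K : ℝ)]
    with m hA hΦm hlogm hc hC hV hVb hB hKN
  rw [Real.dist_eq, abs_lt] at hA
  have hAV : ∑' j, θ m j * z ^ j = (∑' j, θ m j * z ^ j) / V m * V m := by field_simp
  have hmain := mul_meanShort_le (T.theta_zero m) T.c_pos T.c_le_one hc hC hzp hz1'
    (K := K) (N := N m) (by exact_mod_cast hKN) (D := (ρ - R z + δ) * V m) (u := τ * V m)
    (by positivity) ?_ ?_ ?_ s
  · rw [mul_div_assoc', div_le_iff₀ hV]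
    refine hmain.trans ?_
    rw [hN m]
    rw [div_lt_iff₀ hV] at hlogm
    have hsum : ∑ j ∈ Finset.Icc 1 K, θ m j * ((Real.exp (s * j) - 1) / j * z ^ j)
        = (∑ j ∈ Finset.Icc 1 K, θ m j / V m * ((Real.exp (s * j) - 1) / j * z ^ j)) * V m := by
      rw [Finset.sum_mul]
      refine Finset.sum_congr rfl fun j _ => ?_
      field_simp
    rw [hsum]
    have h1 := mul_lt_mul_of_pos_right hΦm hV
    have h2 : (ρ - R z + δ) * V m * (-Real.log z)
        = ((ρ - R z) * (-Real.log z) + κ / 4) * V m := by rw [← hδz]; ring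
    rw [h2]
    have h3 := mul_lt_mul_of_pos_right hzF hV
    nlinarith
  · rw [hAV, hN m, ← add_mul]
    refine mul_le_mul_of_nonneg_right ?_ hV.le
    simp only [R] at hτ1
    linarith
  · rw [hAV, hN m, ← sub_mul, ← sub_mul]
    refine mul_le_mul_of_nonneg_right ?_ hV.le
    simp only [R]
    linarith
  · rw [div_le_iff₀ (by positivity)] at hVb
    calc 2 * ∑' j : ℕ, (j : ℝ) * (θ m j * z ^ j) ≤ 2 * (V m * b) := by linarith
      _ = V m * (2 * b) := by ring
      _ ≤ V m * (V m * τ ^ 2) := mul_le_mul_of_nonneg_left hVb hV.le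
      _ = _ := by ring

/-- In the thermodynamic limit the mean density of points in cycles of length at most `K`
converges. -/
theorem tendsto_meanShort_div (T : IsThermo V θ q c C) {ρ : ℝ} (hρ : 0 < ρ) {N : ℕ → ℕ}
    (hN : ∀ m, (N m : ℝ) = ρ * V m) {z₀ : ℝ} (hz0 : 0 < z₀) (hz1 : z₀ ≤ 1)
    (hle : ∑' j, q j * z₀ ^ j ≤ ρ)
    (hlog : (ρ - ∑' j, q j * z₀ ^ j) * Real.log z₀ = 0) (K : ℕ) :
    Tendsto (fun m => meanShort (θ m) (N m) K / V m) atTop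
      (𝓝 (∑ j ∈ Finset.Icc 1 K, q j * z₀ ^ j)) := by
  refine tendsto_of_forall_mul_le (φ := fun s => ∑ j ∈ Finset.Icc 1 K,
    q j * ((Real.exp (s * j) - 1) / j * z₀ ^ j)) (by simp) ?_
    (T.eventually_mul_meanShort_le hρ hN hz0 hz1 hle hlog K)
  refine HasDerivAt.fun_sum fun j hj => ?_
  have hj0 : (j : ℝ) ≠ 0 := by
    have := (Finset.mem_Icc.1 hj).1
    positivity
  have h1 : HasDerivAt (fun s : ℝ => Real.exp (s * j)) j 0 := by
    simpa using ((hasDerivAt_id (0 : ℝ)).mul_const (j : ℝ)).exp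
  have h2 := ((((h1.sub_const 1).div_const (j : ℝ)).mul_const (z₀ ^ j)).const_mul (q j))
  rwa [div_self hj0, one_mul] at h2

end IsThermo

/-- A continuous integrable nonnegative function whose Fourier transform is nonnegative has an
integrable Fourier transform. -/
theorem integrable_of_fourier_eq {V : Type*} [NormedAddCommGroup V] [InnerProductSpace ℝ V]
    [MeasurableSpace V] [BorelSpace V] [FiniteDimensional ℝ V] {f g : V → ℝ}
    (hf : Integrable f) (hfc : Continuous f) (hg0 : ∀ k, 0 ≤ g k) (hg1 : ∀ k, g k ≤ 1)
    (hgc : Continuous g) (hFT : ∀ k, 𝓕 (fun x => (f x : ℂ)) k = (g k : ℂ)) :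
    Integrable g := by
  have hF : Integrable (fun x => (f x : ℂ)) := hf.ofReal
  have hFc : Continuous (fun x => (f x : ℂ)) := Complex.continuous_ofReal.comp hfc
  have hlim := Real.tendsto_integral_gaussian_smul' hF (v := 0) hFc.continuousAt
  have hgauss : ∀ c : ℝ, 0 < c → Integrable (fun w : V => Real.exp (-c⁻¹ * ‖w‖ ^ 2)) := by
    intro c hc
    have := GaussianFourier.integrable_cexp_neg_mul_sq_norm_add (V := V) (b := (c⁻¹ : ℂ))
      (by simpa using hc) 0 0
    refine this.re.congr (ae_of_all _ fun w => ?_)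
    simp only [neg_mul, zero_mul, add_zero, RCLike.re_to_complex]
    rw [← Complex.ofReal_re (Real.exp _)]
    push_cast
    rfl
  have hint : ∀ c : ℝ, 0 < c → Integrable (fun w : V => Real.exp (-c⁻¹ * ‖w‖ ^ 2) * g w) := by
    intro c hc
    refine (hgauss c hc).mul_bdd (c := 1) hgc.aestronglyMeasurable (ae_of_all _ fun w => ?_)
    rw [Real.norm_eq_abs, abs_of_nonneg (hg0 w)]
    exact hg1 w
  have key : ∀ᶠ c : ℝ in atTop, (∫ w : V, ((Real.pi * c : ℂ) ^ (Module.finrank ℝ V / 2 : ℂ) *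
      Complex.exp (-Real.pi ^ 2 * c * ‖(0 : V) - w‖ ^ 2)) • (f w : ℂ))
      = ((∫ w : V, Real.exp (-c⁻¹ * ‖w‖ ^ 2) * g w : ℝ) : ℂ) := by
    filter_upwards [Ioi_mem_atTop 0] with c (hc : 0 < c)
    have J : Integrable (fun w : V ↦ Complex.exp (-c⁻¹ * ‖w‖ ^ 2 +
        2 * Real.pi * Complex.I * (inner ℝ (0 : V) w : ℝ))) :=
      GaussianFourier.integrable_cexp_neg_mul_sq_norm_add (by simpa) _ _
    have h := VectorFourier.integral_fourierIntegral_smul_eq_flip (L := innerₗ V)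
      Real.continuous_fourierChar continuous_inner J hF
    have h' : (∫ w : V, 𝓕 (fun w : V ↦ Complex.exp (-c⁻¹ * ‖w‖ ^ 2 +
        2 * Real.pi * Complex.I * (inner ℝ (0 : V) w : ℝ))) w • (f w : ℂ))
        = ∫ w : V, Complex.exp (-c⁻¹ * ‖w‖ ^ 2 +
        2 * Real.pi * Complex.I * (inner ℝ (0 : V) w : ℝ)) • 𝓕 (fun x => (f x : ℂ)) w := by
      simpa using! h
    rw [← integral_complex_ofReal]
    calc _ = _ := ?_
      _ = _ := h'
      _ = _ := ?_
    · congr with w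
      rw [fourier_gaussian_innerProductSpace' (by simpa)]
      congr 2
      · simp
      · congr 1
        simp
        ring
    · refine integral_congr_ae (ae_of_all _ fun w => ?_)
      simp only [hFT, inner_zero_left, smul_eq_mul]
      push_cast
      simp
  have hlim2 : Tendsto (fun n : ℕ => ∫ w : V, Real.exp (-(n : ℝ)⁻¹ * ‖w‖ ^ 2) * g w) atTop
      (𝓝 (f 0)) := by
    have h := (hlim.congr' key).comp tendsto_natCast_atTop_atTop
    exact (Complex.continuous_re.tendsto _).comp h
  refine ⟨hgc.aestronglyMeasurable, ?_⟩
  have hlim3 : Tendsto (fun n : ℕ => ∫⁻ w : V,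
      ENNReal.ofReal (Real.exp (-(n : ℝ)⁻¹ * ‖w‖ ^ 2) * g w)) atTop (𝓝 (ENNReal.ofReal (f 0))) := by
    refine (ENNReal.tendsto_ofReal hlim2).congr' ?_
    filter_upwards [eventually_gt_atTop 0] with n hn
    exact ofReal_integral_eq_lintegral_ofReal (hint n (by exact_mod_cast hn))
      (ae_of_all _ fun w => mul_nonneg (Real.exp_pos _).le (hg0 w))
  rw [hasFiniteIntegral_iff_ofReal (ae_of_all _ hg0)]
  calc ∫⁻ w, ENNReal.ofReal (g w)
      = ∫⁻ w, liminf (fun n : ℕ => ENNReal.ofReal (Real.exp (-(n : ℝ)⁻¹ * ‖w‖ ^ 2) * g w))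
          atTop := by
        refine lintegral_congr fun w => (Tendsto.liminf_eq (ENNReal.tendsto_ofReal ?_)).symm
        have h : Tendsto (fun n : ℕ => (n : ℝ)⁻¹) atTop (𝓝 0) :=
          tendsto_inv_atTop_zero.comp tendsto_natCast_atTop_atTop
        simpa using (((Real.continuous_exp.tendsto _).comp (h.neg.mul_const (‖w‖ ^ 2))).mul_const
          (g w))
    _ ≤ liminf (fun n : ℕ => ∫⁻ w : V,
          ENNReal.ofReal (Real.exp (-(n : ℝ)⁻¹ * ‖w‖ ^ 2) * g w)) atTop :=
        lintegral_liminf_le fun n => by fun_prop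
    _ = ENNReal.ofReal (f 0) := hlim3.liminf_eq
    _ < ⊤ := ENNReal.ofReal_lt_top

/-- Partial sums of the powers `e^{-jt}`, `j ≥ 1`, are at most `1/t`. -/
theorem sum_exp_neg_pow_le {t : ℝ} (ht : 0 < t) (n : ℕ) :
    ∑ j ∈ Finset.range n, Real.exp (-t) ^ (j + 1) ≤ Real.exp (-t) / (1 - Real.exp (-t)) := by
  have h0 := Real.exp_pos (-t)
  have h1 : Real.exp (-t) < 1 := Real.exp_lt_one_iff.2 (by linarith)
  simp only [pow_succ]
  rw [← Finset.sum_mul, div_eq_inv_mul, ← tsum_geometric_of_lt_one h0.le h1]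
  exact mul_le_mul_of_nonneg_right
    ((summable_geometric_of_lt_one h0.le h1).sum_le_tsum _ fun j _ => pow_nonneg h0.le j) h0.le

/-- If the dispersion relation vanishes at the origin more slowly than `‖k‖^d`, then the
integrals of `e^{-jε}` are summable over `j ≥ 1`. -/
theorem summable_integral_exp_neg_pow {d : ℕ} {ε : Eu d → ℝ} (hε0 : ∀ k, 0 ≤ ε k)
    (hc : Continuous fun k => Real.exp (-ε k))
    (hint : Integrable fun k => Real.exp (-ε k))
    (hlow : ∃ a > (0 : ℝ), ∃ η : ℝ, 0 < η ∧ η < d ∧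
      ∀ k : Eu d, ‖k‖ ≤ 1 → a * ‖k‖ ^ η ≤ ε k)
    (hpos : ∀ δ : ℝ, 0 < δ → ∃ c > (0 : ℝ), ∀ k : Eu d, δ ≤ ‖k‖ → c ≤ ε k) :
    Summable fun j : ℕ => ∫ k : Eu d, Real.exp (-ε k) ^ (j + 1) := by
  obtain ⟨a, ha, η, hη, hηd, hlow⟩ := hlow
  obtain ⟨c, hc0, hpos⟩ := hpos 1 one_pos
  have hd : 1 ≤ d := by
    have : (0 : ℝ) < d := hη.trans hηd
    exact_mod_cast this
  have hg0 : ∀ k, 0 < Real.exp (-ε k) := fun k => Real.exp_pos _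
  have hg1 : ∀ k, Real.exp (-ε k) ≤ 1 := fun k => Real.exp_le_one_iff.2 (by linarith [hε0 k])
  have hpow : ∀ j : ℕ, Integrable fun k => Real.exp (-ε k) ^ (j + 1) := fun j => by
    refine hint.mono' (hc.pow _).aestronglyMeasurable (ae_of_all _ fun k => ?_)
    rw [Real.norm_eq_abs, abs_of_nonneg (pow_nonneg (hg0 k).le _), pow_succ]
    exact mul_le_of_le_one_left (hg0 k).le (pow_le_one₀ (hg0 k).le (hg1 k))
  have hball : IntegrableOn (fun k : Eu d => a⁻¹ * ‖k‖ ^ (-η)) (Metric.ball 0 1) := by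
    refine integrableOn_ball_of_norm_le_rpow (C := a⁻¹) (α := η) ?_ ?_ ?_ ?_
    · simpa using hd
    · simpa using hηd
    · refine ae_of_all _ fun k => ?_
      rw [Real.norm_eq_abs, abs_of_nonneg]
      positivity
    · exact (Measurable.aestronglyMeasurable (by fun_prop))
  set G : Eu d → ℝ := fun k => (Metric.ball (0 : Eu d) 1).indicator (fun k => a⁻¹ * ‖k‖ ^ (-η)) k
    + (1 - Real.exp (-c))⁻¹ * Real.exp (-ε k)
  have hG : Integrable G :=
    ((integrable_indicator_iff Metric.isOpen_ball.measurableSet).2 hball).add (hint.const_mul _)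
  have hc1 : Real.exp (-c) < 1 := Real.exp_lt_one_iff.2 (by linarith)
  refine summable_of_sum_range_le (c := ∫ k, G k)
    (fun j => integral_nonneg fun k => pow_nonneg (hg0 k).le _) fun n => ?_
  rw [← integral_finsetSum _ fun j _ => hpow j]
  refine integral_mono_ae (integrable_finsetSum _ fun j _ => hpow j) hG ?_
  have hne : ∀ᵐ k : Eu d, k ≠ 0 := by
    have : Nontrivial (Eu d) := Module.nontrivial_of_finrank_pos (R := ℝ)
      (by rw [finrank_euclideanSpace_fin]; omega)
    exact Measure.ae_ne volume 0
  filter_upwards [hne] with k hk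
  have hk' : 0 < ‖k‖ := norm_pos_iff.2 hk
  by_cases hk1 : ‖k‖ < 1
  · have hp : 0 < a * ‖k‖ ^ η := by positivity
    have hεk : 0 < ε k := hp.trans_le (hlow k hk1.le)
    refine (sum_exp_neg_pow_le hεk n).trans ?_
    have h1 : Real.exp (-ε k) / (1 - Real.exp (-ε k)) ≤ (a * ‖k‖ ^ η)⁻¹ := by
      have h2 := Real.add_one_le_exp (ε k)
      have h3 : Real.exp (-ε k) / (1 - Real.exp (-ε k)) = (Real.exp (ε k) - 1)⁻¹ := by
        have h4 : Real.exp (ε k) ≠ 0 := (Real.exp_pos _).ne'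
        rw [Real.exp_neg, ← one_div_div, one_div]
        congr 1
        field_simp
      rw [h3]
      exact inv_anti₀ hp (by linarith [hlow k hk1.le])
    have h5 : G k = a⁻¹ * ‖k‖ ^ (-η) + (1 - Real.exp (-c))⁻¹ * Real.exp (-ε k) := by
      simp only [G]
      rw [Set.indicator_of_mem (by simpa using hk1)]
    rw [h5, Real.rpow_neg hk'.le, ← mul_inv]
    have h6 : 0 ≤ (1 - Real.exp (-c))⁻¹ * Real.exp (-ε k) :=
      mul_nonneg (inv_nonneg.2 (by linarith)) (hg0 k).le
    linarith
  · have hεk := hpos k (not_lt.1 hk1)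
    refine (sum_exp_neg_pow_le (hc0.trans_le hεk) n).trans ?_
    have h5 : G k = (1 - Real.exp (-c))⁻¹ * Real.exp (-ε k) := by
      simp only [G]
      rw [Set.indicator_of_notMem (by simpa using hk1), zero_add]
    rw [h5, div_eq_inv_mul]
    refine mul_le_mul_of_nonneg_right (inv_anti₀ (by linarith) ?_) (hg0 k).le
    have := Real.exp_le_exp.2 (neg_le_neg hεk)
    linarith

/-- The integral of a function sampled at the lattice points of mesh `1/L` is the corresponding
Riemann sum. -/
theorem lintegral_comp_dualPt_floor {d : ℕ} {L : ℝ} (hL : 0 < L) (φ : Eu d → ℝ≥0∞) :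
    ∫⁻ x : Eu d, φ (dualPt d L fun i => ⌊L * x i⌋)
      = ∑' z : Fin d → ℤ, φ (dualPt d L z) * ENNReal.ofReal ((L ^ d)⁻¹) := by
  have hF : Measurable fun (x : Eu d) (i : Fin d) => ⌊L * x i⌋ :=
    measurable_pi_lambda _ fun i => Int.measurable_floor.comp (by fun_prop)
  have hvol : ∀ z : Fin d → ℤ,
      volume ((fun (x : Eu d) (i : Fin d) => ⌊L * x i⌋) ⁻¹' {z}) = ENNReal.ofReal ((L ^ d)⁻¹) := by
    intro z
    have hset : (fun (x : Eu d) (i : Fin d) => ⌊L * x i⌋) ⁻¹' {z}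
        = (MeasurableEquiv.toLp 2 (Fin d → ℝ)).symm ⁻¹'
          (Set.univ.pi fun i => Set.Ico ((z i : ℝ) / L) ((z i + 1) / L)) := by
      ext x
      simp only [Set.mem_preimage, Set.mem_singleton_iff, funext_iff, Int.floor_eq_iff,
        Set.mem_pi, Set.mem_univ, true_imp_iff, Set.mem_Ico, div_le_iff₀ hL, lt_div_iff₀ hL]
      simp [mul_comm L]
    rw [hset, (EuclideanSpace.volume_preserving_symm_measurableEquiv_toLp
      (Fin d)).measure_preimage_equiv, Real.volume_pi_Ico]
    simp only [← sub_div, add_sub_cancel_left, Finset.prod_const, Finset.card_univ,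
      Fintype.card_fin]
    rw [← ENNReal.ofReal_pow (by positivity), one_div, inv_pow]
  calc ∫⁻ x : Eu d, φ (dualPt d L fun i => ⌊L * x i⌋)
      = ∫⁻ z, φ (dualPt d L z) ∂(volume.map fun (x : Eu d) (i : Fin d) => ⌊L * x i⌋) :=
        (lintegral_map (f := fun z => φ (dualPt d L z)) (measurable_of_countable _) hF).symm
    _ = _ := by
        rw [lintegral_countable']
        refine tsum_congr fun z => ?_
        rw [Measure.map_apply hF (measurableSet_singleton z), hvol]

/-- The lattice points of mesh `1/L` approximate every point as `L → ∞`. -/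
theorem tendsto_dualPt_floor {d : ℕ} (x : Eu d) :
    Tendsto (fun L : ℝ => dualPt d L fun i => ⌊L * x i⌋) atTop (𝓝 x) := by
  have h : Tendsto (fun (L : ℝ) (i : Fin d) => (⌊L * x i⌋ : ℝ) / L) atTop (𝓝 fun i => x i) := by
    refine tendsto_pi_nhds.2 fun i => ?_
    have h1 : Tendsto (fun L : ℝ => x i - L⁻¹) atTop (𝓝 (x i)) := by
      simpa using tendsto_inv_atTop_zero.const_sub (x i)
    refine tendsto_of_tendsto_of_tendsto_of_le_of_le' h1 tendsto_const_nhds ?_ ?_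
    · filter_upwards [eventually_gt_atTop 0] with L hL
      rw [le_div_iff₀ hL, sub_mul, inv_mul_cancel₀ hL.ne']
      linarith [Int.sub_one_lt_floor (L * x i)]
    · filter_upwards [eventually_gt_atTop 0] with L hL
      rw [div_le_iff₀ hL]
      linarith [Int.floor_le (L * x i)]
  exact ((PiLp.continuous_toLp 2 (fun _ : Fin d => ℝ)).tendsto _).comp h

/-- Fatou's lemma for Riemann sums. -/
theorem eventually_lt_riemannSum {d : ℕ} {φ : Eu d → ℝ} (hφ : Continuous φ) (h0 : ∀ x, 0 ≤ φ x)
    (hint : Integrable φ) {Ls : ℕ → ℝ} (hLs : Tendsto Ls atTop atTop)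
    (hs : ∀ᶠ m in atTop, Summable fun z => φ (dualPt d (Ls m) z)) {A : ℝ} (hA : A < ∫ x, φ x) :
    ∀ᶠ m in atTop, A < (Ls m ^ d)⁻¹ * ∑' z, φ (dualPt d (Ls m) z) := by
  rcases lt_or_ge A 0 with hA0 | hA0
  · filter_upwards [hLs.eventually_gt_atTop 0] with m hm
    exact hA0.trans_le (mul_nonneg (by positivity) (tsum_nonneg fun z => h0 _))
  have hfatou : ∫⁻ x, ENNReal.ofReal (φ x)
      ≤ liminf (fun m => ∫⁻ x : Eu d,
          ENNReal.ofReal (φ (dualPt d (Ls m) fun i => ⌊Ls m * x i⌋))) atTop := by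
    refine le_trans (le_of_eq (lintegral_congr fun x => ?_)) (lintegral_liminf_le fun m => ?_)
    · refine (Tendsto.liminf_eq (ENNReal.tendsto_ofReal ?_)).symm
      exact (hφ.tendsto x).comp ((tendsto_dualPt_floor x).comp hLs)
    · refine ENNReal.measurable_ofReal.comp (hφ.measurable.comp ?_)
      have hF : Measurable fun (x : Eu d) (i : Fin d) => ⌊Ls m * x i⌋ :=
        measurable_pi_lambda _ fun i => Int.measurable_floor.comp (by fun_prop)
      exact (measurable_of_countable (dualPt d (Ls m))).comp hF
  have hlt : ENNReal.ofReal A < liminf (fun m => ∫⁻ x : Eu d,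
          ENNReal.ofReal (φ (dualPt d (Ls m) fun i => ⌊Ls m * x i⌋))) atTop := by
    refine lt_of_lt_of_le ?_ hfatou
    rw [← ofReal_integral_eq_lintegral_ofReal hint (ae_of_all _ h0)]
    exact (ENNReal.ofReal_lt_ofReal_iff (hA0.trans_lt hA)).2 hA
  filter_upwards [eventually_lt_of_lt_liminf hlt, hs, hLs.eventually_gt_atTop 0] with m hm hsm hL
  rw [lintegral_comp_dualPt_floor hL (fun k => ENNReal.ofReal (φ k)), ENNReal.tsum_mul_right,
    ← ENNReal.ofReal_tsum_of_nonneg (fun z => h0 _) hsm,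
    ← ENNReal.ofReal_mul (tsum_nonneg fun z => h0 _), mul_comm] at hm
  exact (ENNReal.ofReal_lt_ofReal_iff_of_nonneg hA0).1 hm

/-- If the Riemann sums of `φ` converge, then so do those of any continuous `ψ` with
`0 ≤ ψ ≤ φ`. -/
theorem tendsto_riemannSum_of_le {d : ℕ} {φ ψ : Eu d → ℝ} (hφ : Continuous φ) (hψ : Continuous ψ)
    (h0 : ∀ x, 0 ≤ ψ x) (hle : ∀ x, ψ x ≤ φ x) (hint : Integrable φ) {Ls : ℕ → ℝ}
    (hLs : Tendsto Ls atTop atTop)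
    (hs : ∀ᶠ m in atTop, Summable fun z => φ (dualPt d (Ls m) z))
    (hlim : Tendsto (fun m => (Ls m ^ d)⁻¹ * ∑' z, φ (dualPt d (Ls m) z)) atTop
      (𝓝 (∫ x, φ x))) :
    Tendsto (fun m => (Ls m ^ d)⁻¹ * ∑' z, ψ (dualPt d (Ls m) z)) atTop (𝓝 (∫ x, ψ x)) := by
  have hψint : Integrable ψ := hint.mono' hψ.aestronglyMeasurable (ae_of_all _ fun x => by
    rw [Real.norm_eq_abs, abs_of_nonneg (h0 x)]; exact hle x)
  have hψs : ∀ᶠ m in atTop, Summable fun z => ψ (dualPt d (Ls m) z) := by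
    filter_upwards [hs] with m hm
    exact Summable.of_nonneg_of_le (fun z => h0 _) (fun z => hle _) hm
  have hds : ∀ᶠ m in atTop, Summable fun z => (φ - ψ) (dualPt d (Ls m) z) := by
    filter_upwards [hs, hψs] with m h1 h2
    exact h1.sub h2
  rw [tendsto_order]
  refine ⟨fun A hA => eventually_lt_riemannSum hψ h0 hψint hLs hψs hA, fun A hA => ?_⟩
  obtain ⟨δ, hδ, hAδ⟩ : ∃ δ > 0, (∫ x, ψ x) + 2 * δ = A :=
    ⟨(A - ∫ x, ψ x) / 2, by linarith, by ring⟩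
  have hd : (∫ x, φ x) - (∫ x, ψ x) - δ < ∫ x, (φ - ψ) x := by
    simp only [Pi.sub_apply]
    rw [integral_sub hint hψint]
    linarith
  filter_upwards [eventually_lt_riemannSum (hφ.sub hψ) (fun x => sub_nonneg.2 (hle x))
    (hint.sub hψint) hLs hds hd, hlim.eventually_lt_const
    (show ∫ x, φ x < (∫ x, φ x) + δ by linarith), hs, hψs] with m h1 h2 h3 h4
  simp only [Pi.sub_apply] at h1
  rw [h3.tsum_sub h4, mul_sub] at h1
  linarith

/-- The normalized Haar measure on the torus `(ℝ/ℤ)^d`. -/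
def torusHaar (d : ℕ) : Measure (UnitAddTorus (Fin d)) :=
  Measure.pi fun _ => AddCircle.haarAddCircle

instance (d : ℕ) : IsProbabilityMeasure (torusHaar d) :=
  inferInstanceAs (IsProbabilityMeasure (Measure.pi fun _ => AddCircle.haarAddCircle))

instance (d : ℕ) : Measure.IsOpenPosMeasure (torusHaar d) :=
  inferInstanceAs (Measure.IsOpenPosMeasure (Measure.pi fun _ : Fin d => AddCircle.haarAddCircle))

/-- The projection of `ℝ^d` onto the torus `ℝ^d/Lℤ^d ≃ (ℝ/ℤ)^d`. -/
def torusPt (d : ℕ) (L : ℝ) (x : Eu d) : UnitAddTorus (Fin d) :=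
  fun i => ((x i / L : ℝ) : UnitAddCircle)

theorem continuous_torusPt (d : ℕ) (L : ℝ) : Continuous (torusPt d L) :=
  continuous_pi fun i => (AddCircle.continuous_mk' 1).comp (by fun_prop)

theorem torusPt_sub {d : ℕ} {L : ℝ} (x y : Eu d) :
    torusPt d L (x - y) = torusPt d L x - torusPt d L y := by
  ext i
  simp [torusPt, sub_div]

theorem torusPt_sub_latPt {d : ℕ} {L : ℝ} (hL : L ≠ 0) (x : Eu d) (z : Fin d → ℤ) :
    torusPt d L (x - latPt d L z) = torusPt d L x := by
  rw [torusPt_sub, sub_eq_self]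
  ext i
  simp only [torusPt, latPt, Pi.zero_apply, WithLp.equiv_symm_apply]
  rw [mul_div_cancel_left₀ _ hL, AddCircle.coe_eq_zero_iff]
  exact ⟨z i, by simp⟩

theorem isQuotientMap_torusPt {d : ℕ} {L : ℝ} (hL : L ≠ 0) :
    IsQuotientMap (torusPt d L) := by
  have h1 : IsOpenQuotientMap (Pi.map fun (_ : Fin d) (r : ℝ) => (r : UnitAddCircle)) :=
    IsOpenQuotientMap.piMap fun _ => QuotientAddGroup.isOpenQuotientMap_mk
  let e : Eu d ≃ₜ (Fin d → ℝ) :=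
    (Homeomorph.smulOfNeZero L⁻¹ (inv_ne_zero hL)).trans (PiLp.homeomorph 2 fun _ : Fin d => ℝ)
  have h2 : torusPt d L = (Pi.map fun (_ : Fin d) (r : ℝ) => (r : UnitAddCircle)) ∘ e := by
    ext x i
    simp [torusPt, e, div_eq_inv_mul, PiLp.homeomorph]
  rw [h2]
  exact h1.isQuotientMap.comp e.isQuotientMap

theorem torusPt_eq_iff {d : ℕ} {L : ℝ} (hL : L ≠ 0) {x y : Eu d}
    (h : torusPt d L x = torusPt d L y) : ∃ z, x = y - latPt d L z := by
  have h' : ∀ i, ∃ n : ℤ, x i / L - y i / L = n := fun i => by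
    have h1 : (((x i / L - y i / L : ℝ)) : UnitAddCircle) = 0 := by
      rw [AddCircle.coe_sub, sub_eq_zero]
      exact congrFun h i
    obtain ⟨n, hn⟩ := (AddCircle.coe_eq_zero_iff 1).1 h1
    exact ⟨n, by rw [← hn]; simp⟩
  choose n hn using h'
  refine ⟨fun i => -n i, ?_⟩
  ext i
  have := hn i
  simp only [latPt, WithLp.equiv_symm_apply, PiLp.sub_apply]
  push_cast
  rw [← this]
  field_simp
  ring

theorem fper_sub_latPt {d : ℕ} (f : Eu d → ℝ) (L : ℝ) (x : Eu d) (z : Fin d → ℤ) :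
    fper d f L (x - latPt d L z) = fper d f L x := by
  unfold fper
  rw [← (Equiv.addLeft z).tsum_eq fun w => ENNReal.ofReal (f (x - latPt d L w))]
  refine tsum_congr fun w => ?_
  congr 2
  ext i
  simp [latPt]
  ring

/-- The periodization, as a function on the torus. -/
theorem exists_fper_eq_comp {d : ℕ} {f : Eu d → ℝ} {L : ℝ} (hL : L ≠ 0)
    (hc : Continuous (fper d f L)) :
    ∃ H : UnitAddTorus (Fin d) → ℝ≥0∞, Continuous H ∧ ∀ x, fper d f L x = H (torusPt d L x) := by
  have hq := isQuotientMap_torusPt (d := d) hL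
  have hfac : Function.FactorsThrough (fper d f L) (torusPt d L) := fun x y hxy => by
    obtain ⟨z, rfl⟩ := torusPt_eq_iff hL hxy
    exact fper_sub_latPt f L y z
  let F : C(Eu d, ℝ≥0∞) := ⟨fper d f L, hc⟩
  let q : C(Eu d, UnitAddTorus (Fin d)) := ⟨torusPt d L, continuous_torusPt d L⟩
  have hq' : IsQuotientMap q := hq
  refine ⟨hq'.lift F hfac, (hq'.lift F hfac).continuous, fun x => ?_⟩
  exact (DFunLike.congr_fun (hq'.lift_comp F hfac) x).symm

theorem measurableSet_cube (d : ℕ) (L : ℝ) : MeasurableSet (cube d L) := by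
  have : cube d L = ⋂ i, (fun x : Eu d => x i) ⁻¹' Set.Ico 0 L := by ext; simp [cube]
  rw [this]
  exact MeasurableSet.iInter fun i => measurableSet_Ico.preimage (by fun_prop)

/-- Integration over the cube of a function on the torus. -/
theorem lintegral_cube_comp_torusPt {d : ℕ} {L : ℝ} (hL : 0 < L)
    {φ : UnitAddTorus (Fin d) → ℝ≥0∞} (hφ : Measurable φ) :
    ∫⁻ x in cube d L, φ (torusPt d L x) = ENNReal.ofReal (L ^ d) * ∫⁻ t, φ t ∂torusHaar d := by
  have hq : Measurable fun (y : Fin d → ℝ) (i : Fin d) => ((y i / L : ℝ) : UnitAddCircle) :=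
    measurable_pi_lambda _ fun i => AddCircle.measurable_mk'.comp (by fun_prop)
  have h1 : ∫⁻ x in cube d L, φ (torusPt d L x)
      = ∫⁻ y in Set.univ.pi fun _ : Fin d => Set.Ico (0 : ℝ) L,
        φ (fun i => ((y i / L : ℝ) : UnitAddCircle)) := by
    have hmp := EuclideanSpace.volume_preserving_symm_measurableEquiv_toLp (Fin d)
    have hset : cube d L = (MeasurableEquiv.toLp 2 (Fin d → ℝ)).symm ⁻¹'
        (Set.univ.pi fun _ => Set.Ico (0 : ℝ) L) := by
      ext x; simp [cube]
    rw [hset]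
    exact hmp.setLIntegral_comp_preimage (MeasurableSet.univ_pi fun _ => measurableSet_Ico)
      (hφ.comp hq)
  set S := Set.univ.pi fun _ : Fin d => Set.Ico (0 : ℝ) L
  have hS : MeasurableSet S := MeasurableSet.univ_pi fun _ => measurableSet_Ico
  have h2 : ∫⁻ y : Fin d → ℝ, S.indicator (fun y => φ (fun i => ((y i / L : ℝ) : UnitAddCircle)))
      (L • y) = ENNReal.ofReal (L ^ d)⁻¹ * ∫⁻ y in S,
        φ (fun i => ((y i / L : ℝ) : UnitAddCircle)) := by
    rw [← lintegral_indicator hS,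
      ← lintegral_map (f := S.indicator fun y => φ (fun i => ((y i / L : ℝ) : UnitAddCircle)))
      ((hφ.comp hq).indicator hS) (measurable_const_smul L),
      Measure.map_addHaar_smul _ hL.ne', lintegral_smul_measure, smul_eq_mul]
    simp [abs_of_pos hL]
  have h3 : ∫⁻ y : Fin d → ℝ, S.indicator (fun y => φ (fun i => ((y i / L : ℝ) : UnitAddCircle)))
      (L • y) = ∫⁻ y in Set.univ.pi fun _ : Fin d => Set.Ico (0 : ℝ) 1,
        φ (fun i => (y i : UnitAddCircle)) := by
    rw [← lintegral_indicator (MeasurableSet.univ_pi fun _ => measurableSet_Ico)]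
    refine lintegral_congr fun y => ?_
    have hmem : L • y ∈ S ↔ y ∈ Set.univ.pi fun _ : Fin d => Set.Ico (0 : ℝ) 1 := by
      simp only [S, Set.mem_pi, Set.mem_univ, true_imp_iff, Set.mem_Ico, Pi.smul_apply,
        smul_eq_mul]
      refine forall_congr' fun i => ?_
      rw [mul_nonneg_iff_of_pos_left hL, mul_lt_iff_lt_one_right hL]
    by_cases hy : y ∈ Set.univ.pi fun _ : Fin d => Set.Ico (0 : ℝ) 1
    · rw [Set.indicator_of_mem hy, Set.indicator_of_mem (hmem.2 hy)]
      congr 1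
      ext i
      simp [mul_div_cancel_left₀ _ hL.ne']
    · rw [Set.indicator_of_notMem hy, Set.indicator_of_notMem (mt hmem.1 hy)]
  have h4 : ∫⁻ t, φ t ∂torusHaar d = ∫⁻ y in Set.univ.pi fun _ : Fin d => Set.Ico (0 : ℝ) 1,
        φ (fun i => (y i : UnitAddCircle)) := by
    have h : ∫⁻ t, φ t ∂torusHaar d = ∫⁻ y in {y : Fin d → ℝ | ∀ i, y i ∈ Set.Ioc (0 : ℝ) (0 + 1)},
        φ (fun i => (y i : UnitAddCircle)) := UnitAddTorus.lintegral_preimage φ 0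
    rw [h]
    refine setLIntegral_congr ?_
    have : {y : Fin d → ℝ | ∀ i, y i ∈ Set.Ioc (0 : ℝ) (0 + 1)}
        = Set.univ.pi fun _ : Fin d => Set.Ioc (0 : ℝ) 1 := by ext; simp
    rw [this]
    exact (Measure.univ_pi_Ioc_ae_eq_Icc (f := fun _ => (0 : ℝ)) (g := fun _ => 1)).trans
      (Measure.univ_pi_Ico_ae_eq_Icc (f := fun _ => (0 : ℝ)) (g := fun _ => 1)).symm
  have hLd : 0 < L ^ d := by positivity
  rw [h4, ← h3, h2, h1, ← mul_assoc, ← ENNReal.ofReal_mul hLd.le, mul_inv_cancel₀ hLd.ne',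
    ENNReal.ofReal_one, one_mul]

theorem measurePreserving_torusPt {d : ℕ} {L : ℝ} (hL : 0 < L) :
    MeasurePreserving (torusPt d L) (volume.restrict (cube d L))
      (ENNReal.ofReal (L ^ d) • torusHaar d) := by
  refine ⟨(continuous_torusPt d L).measurable, Measure.ext fun s hs => ?_⟩
  have h := lintegral_cube_comp_torusPt (d := d) hL (measurable_one.indicator hs)
  rw [lintegral_indicator_one hs] at h
  rw [Measure.map_apply (continuous_torusPt d L).measurable hs, Measure.smul_apply, smul_eq_mul,
    ← h, ← lintegral_indicator_one (hs.preimage (continuous_torusPt d L).measurable)]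
  rfl

/-- Unfolding the periodization. -/
theorem lintegral_comp_torusPt_mul {d : ℕ} {L : ℝ} (hL : 0 < L) {f : Eu d → ℝ}
    (hf : Measurable f) {φ : UnitAddTorus (Fin d) → ℝ≥0∞} (hφ : Measurable φ) :
    ∫⁻ x, φ (torusPt d L x) * ENNReal.ofReal (f x)
      = ∫⁻ x in cube d L, φ (torusPt d L x) * fper d f L x := by
  have hψ : Measurable fun x => φ (torusPt d L x) * ENNReal.ofReal (f x) :=
    (hφ.comp (continuous_torusPt d L).measurable).mul hf.ennreal_ofReal
  have hA : ∀ z : Fin d → ℤ, MeasurableSet ((fun x => x + latPt d L z) ⁻¹' cube d L) := fun z =>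
    (measurableSet_cube d L).preimage (measurable_add_const _)
  have hmem : ∀ (z : Fin d → ℤ) (x : Eu d),
      x ∈ (fun x => x + latPt d L z) ⁻¹' cube d L ↔ z = fun i => -⌊x i / L⌋ := by
    intro z x
    simp only [cube, latPt, Set.mem_preimage, Set.mem_ofPred_eq, PiLp.add_apply,
      WithLp.equiv_symm_apply, Set.mem_Ico, funext_iff]
    refine forall_congr' fun i => ?_
    rw [← neg_eq_iff_eq_neg, eq_comm (a := -z i), Int.floor_eq_iff,
      le_div_iff₀ hL, div_lt_iff₀ hL]
    push_cast
    constructor <;> rintro ⟨h1, h2⟩ <;> constructor <;> linarith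
  have hdisj : Pairwise (Function.onFun Disjoint fun z : Fin d → ℤ =>
      (fun x => x + latPt d L z) ⁻¹' cube d L) := fun z w hzw =>
    Set.disjoint_left.2 fun x hx hy => hzw (((hmem z x).1 hx).trans ((hmem w x).1 hy).symm)
  have hunion : ⋃ z : Fin d → ℤ, (fun x => x + latPt d L z) ⁻¹' cube d L = Set.univ :=
    Set.eq_univ_of_forall fun x => Set.mem_iUnion.2 ⟨_, (hmem _ x).2 rfl⟩
  rw [← setLIntegral_univ, ← hunion, lintegral_iUnion hA hdisj]
  have hz : ∀ z : Fin d → ℤ, ∫⁻ x in (fun x => x + latPt d L z) ⁻¹' cube d L,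
      φ (torusPt d L x) * ENNReal.ofReal (f x)
      = ∫⁻ x in cube d L, φ (torusPt d L x) * ENNReal.ofReal (f (x - latPt d L z)) := by
    intro z
    have hm : Measurable fun x => φ (torusPt d L x) * ENNReal.ofReal (f (x - latPt d L z)) :=
      (hφ.comp (continuous_torusPt d L).measurable).mul
        (hf.comp (measurable_sub_const _)).ennreal_ofReal
    rw [← (measurePreserving_add_right volume (latPt d L z)).setLIntegral_comp_preimage
      (measurableSet_cube d L) hm]
    refine lintegral_congr fun x => ?_
    rw [add_sub_cancel_right, ← torusPt_sub_latPt hL.ne' (x + latPt d L z) z,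
      add_sub_cancel_right]
  simp_rw [hz]
  rw [← lintegral_tsum fun z => ?_]
  · refine lintegral_congr fun x => ?_
    rw [fper, ENNReal.tsum_mul_left]
  · exact ((hφ.comp (continuous_torusPt d L).measurable).mul
        (hf.comp (measurable_sub_const _)).ennreal_ofReal).aemeasurable

theorem integral_mFourier (d : ℕ) (n : Fin d → ℤ) :
    ∫ t, UnitAddTorus.mFourier n t ∂torusHaar d = if n = 0 then 1 else 0 := by
  split_ifs with h
  · simp [h, UnitAddTorus.mFourier_zero]
  · obtain ⟨i, hi⟩ := Function.ne_iff.mp h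
    have h1 : ∫ t, UnitAddTorus.mFourier n t ∂torusHaar d
        = ∏ i, ∫ x, fourier (n i) x ∂(AddCircle.haarAddCircle (T := 1)) :=
      integral_fintype_prod_eq_prod fun i (x : UnitAddCircle) => (fourier (n i) x : ℂ)
    rw [h1]
    exact Finset.prod_eq_zero (Finset.mem_univ i)
      (integral_eq_zero_of_add_right_eq_neg (fourier_add_half_inv_index hi one_pos))

theorem norm_mFourier_apply {d : ℕ} (n : Fin d → ℤ) (t : UnitAddTorus (Fin d)) :
    ‖UnitAddTorus.mFourier n t‖ = 1 := by
  simp only [UnitAddTorus.mFourier, ContinuousMap.coe_mk, norm_prod, fourier_apply,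
    Circle.norm_coe, Finset.prod_const_one]

theorem mFourier_torusPt {d : ℕ} (n : Fin d → ℤ) (L : ℝ) (x : Eu d) :
    UnitAddTorus.mFourier n (torusPt d L x)
      = Complex.exp (↑(-2 * Real.pi * inner ℝ x (-dualPt d L n)) * Complex.I) := by
  simp only [UnitAddTorus.mFourier, torusPt, ContinuousMap.coe_mk, fourier_coe_apply]
  rw [← Complex.exp_sum]
  congr 1
  simp only [inner_neg_right, PiLp.inner_apply, dualPt, WithLp.equiv_symm_apply,
    RCLike.inner_apply, conj_trivial]
  push_cast
  rw [← Finset.sum_neg_distrib, Finset.mul_sum, Finset.sum_mul]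
  refine Finset.sum_congr rfl fun i _ => ?_
  ring

/-- The Fourier transform of a real function is even if it is real. -/
theorem fourier_real_even {V : Type*} [NormedAddCommGroup V] [InnerProductSpace ℝ V]
    [MeasurableSpace V] [BorelSpace V] [FiniteDimensional ℝ V] {f g : V → ℝ}
    (hFT : ∀ k, 𝓕 (fun x => (f x : ℂ)) k = (g k : ℂ)) (k : V) : g (-k) = g k := by
  have h := congrArg (starRingEnd ℂ) (hFT k)
  rw [Complex.conj_ofReal, Real.fourier_eq', ← integral_conj] at h
  have h2 := hFT (-k)
  rw [Real.fourier_eq'] at h2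
  refine Complex.ofReal_injective (h2.symm.trans (Eq.trans ?_ h))
  refine integral_congr_ae (ae_of_all _ fun v => ?_)
  simp only [smul_eq_mul, map_mul, Complex.conj_ofReal, ← Complex.exp_conj, Complex.conj_I,
    inner_neg_right]
  push_cast
  congr 2
  ring

/-- A finite measure on the torus is determined by its Fourier coefficients. -/
theorem measure_torus_ext {d : ℕ} {μ ν : Measure (UnitAddTorus (Fin d))} [IsFiniteMeasure μ]
    [IsFiniteMeasure ν]
    (h : ∀ n, ∫ t, UnitAddTorus.mFourier n t ∂μ = ∫ t, UnitAddTorus.mFourier n t ∂ν) : μ = ν := by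
  refine ext_of_forall_mem_subalgebra_integral_eq_of_polish (𝕜 := ℂ)
    (A := (UnitAddTorus.mFourierSubalgebra (Fin d)).comap
      (BoundedContinuousFunction.toContinuousMapStarₐ ℂ)) ?_ ?_
  · intro x y hxy
    obtain ⟨_, ⟨φ, hφ, rfl⟩, hne⟩ := UnitAddTorus.mFourierSubalgebra_separatesPoints hxy
    refine ⟨_, ⟨φ, ⟨BoundedContinuousFunction.mkOfCompact φ, ?_, ?_⟩, rfl⟩, hne⟩
    · exact hφ
    · rfl
  · intro φ hφ
    have hspan : φ.toContinuousMap ∈ Submodule.span ℂ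
        (Set.range (UnitAddTorus.mFourier (d := Fin d))) := by
      rw [← UnitAddTorus.mFourierSubalgebra_coe]
      exact hφ
    have hint : ∀ (κ : Measure (UnitAddTorus (Fin d))) [IsFiniteMeasure κ]
        (ψ : C(UnitAddTorus (Fin d), ℂ)), Integrable (fun t => ψ t) κ := fun κ _ ψ =>
      (BoundedContinuousFunction.mkOfCompact ψ).integrable κ
    have key : ∀ ψ ∈ Submodule.span ℂ (Set.range (UnitAddTorus.mFourier (d := Fin d))),
        ∫ t, ψ t ∂μ = ∫ t, ψ t ∂ν := by
      intro ψ hψ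
      induction hψ using Submodule.span_induction with
      | mem x hx => obtain ⟨n, rfl⟩ := hx; exact h n
      | zero => simp
      | add x y _ _ hx hy =>
        simp only [ContinuousMap.add_apply]
        rw [integral_add (hint μ x) (hint μ y), integral_add (hint ν x) (hint ν y), hx, hy]
      | smul a x _ hx =>
        simp only [ContinuousMap.smul_apply]
        rw [integral_smul, integral_smul, hx]
    exact key _ hspan

theorem dualPt_neg {d : ℕ} (L : ℝ) (z : Fin d → ℤ) : dualPt d L (-z) = -dualPt d L z := by
  ext i
  simp [dualPt, neg_div]

/-- Poisson summation: if the samples of `f̂` on the dual lattice are nonnegative and summable,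
then the continuous periodization of `f` is given by its Fourier series. -/
theorem exists_periodization_eq {d : ℕ} {L : ℝ} (hL : 0 < L) {f g : Eu d → ℝ}
    (hf : Integrable f) (hfc : Continuous f) (hf0 : ∀ x, 0 ≤ f x)
    (hFT : ∀ k, 𝓕 (fun x => (f x : ℂ)) k = (g k : ℂ)) (hg0 : ∀ k, 0 ≤ g k)
    (hs : Summable fun z => g (dualPt d L z)) {H : UnitAddTorus (Fin d) → ℝ≥0∞}
    (hH : Continuous H) (hfH : ∀ x, fper d f L x = H (torusPt d L x)) :
    ∃ h : UnitAddTorus (Fin d) → ℝ, Continuous h ∧ (∀ t, 0 ≤ h t) ∧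
      (∀ t, H t = ENNReal.ofReal (h t)) ∧
      ∀ t, (h t : ℂ) = ∑' z, (((L ^ d)⁻¹ * g (dualPt d L z) : ℝ) : ℂ) *
        UnitAddTorus.mFourier z t := by
  have hLd : 0 < L ^ d := by positivity
  set c : (Fin d → ℤ) → ℝ := fun z => (L ^ d)⁻¹ * g (dualPt d L z) with hcdef
  have hc0 : ∀ z, 0 ≤ c z := fun z => mul_nonneg (inv_nonneg.2 hLd.le) (hg0 _)
  have hcs : Summable c := hs.mul_left _
  have hceven : ∀ z, c (-z) = c z := fun z => by
    simp only [hcdef, dualPt_neg, fourier_real_even hFT]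
  have hnorm : ∀ z t, ‖(c z : ℂ) * UnitAddTorus.mFourier z t‖ = c z := fun z t => by
    rw [norm_mul, norm_mFourier_apply, mul_one, Complex.norm_real, Real.norm_eq_abs,
      abs_of_nonneg (hc0 z)]
  set G : UnitAddTorus (Fin d) → ℂ := fun t => ∑' z, (c z : ℂ) * UnitAddTorus.mFourier z t with hG
  have hGc : Continuous G :=
    continuous_tsum (fun z => by fun_prop) hcs fun z t => (hnorm z t).le
  have hGs : ∀ t, Summable fun z => (c z : ℂ) * UnitAddTorus.mFourier z t := fun t =>
    Summable.of_norm (by simpa only [hnorm] using hcs)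
  have hGreal : ∀ t, ((G t).re : ℂ) = G t := by
    intro t
    rw [← Complex.conj_eq_iff_re]
    simp only [hG]
    rw [Complex.conj_tsum, ← (Equiv.neg (Fin d → ℤ)).tsum_eq]
    refine tsum_congr fun z => ?_
    rw [Equiv.neg_apply, map_mul, Complex.conj_ofReal, UnitAddTorus.mFourier_neg,
      Complex.conj_conj, hceven]
  set C := ∑' z, c z
  have hC0 : 0 ≤ C := tsum_nonneg hc0
  have hGle : ∀ t, ‖G t‖ ≤ C := fun t =>
    (norm_tsum_le_tsum_norm (by simpa only [hnorm] using hcs)).trans (by simp only [hnorm, C, le_refl])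
  have hGre : ∀ t, 0 ≤ (G t).re + C := fun t => by
    have := (abs_le.1 ((Complex.abs_re_le_norm (G t)).trans (hGle t))).1
    linarith
  have hrec : Continuous fun t => (G t).re := Complex.continuous_re.comp hGc
  have hτ := (continuous_torusPt d L).measurable
  let μ₁ : Measure (UnitAddTorus (Fin d)) := (ENNReal.ofReal (L ^ d)⁻¹) •
    ((volume.withDensity fun x => ENNReal.ofReal (f x)).map (torusPt d L))
  let μ₂ : Measure (UnitAddTorus (Fin d)) := ENNReal.ofReal C • torusHaar d
  have hfin : IsFiniteMeasure (volume.withDensity fun x => ENNReal.ofReal (f x)) :=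
    isFiniteMeasure_withDensity_ofReal hf.2
  have hfin1 : IsFiniteMeasure μ₁ := by
    have : IsFiniteMeasure ((volume.withDensity fun x => ENNReal.ofReal (f x)).map
      (torusPt d L)) := inferInstance
    exact Measure.smul_finite _ ENNReal.ofReal_ne_top
  have hfin2 : IsFiniteMeasure μ₂ := Measure.smul_finite _ ENNReal.ofReal_ne_top
  have hνint : Integrable (fun t => (G t).re + C) (torusHaar d) :=
    (BoundedContinuousFunction.mkOfCompact (⟨fun t => (G t).re + C, hrec.add_const C⟩ :
      C(UnitAddTorus (Fin d), ℝ))).integrable _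
  have hfin3 : IsFiniteMeasure ((torusHaar d).withDensity fun t => ENNReal.ofReal ((G t).re + C)) :=
    isFiniteMeasure_withDensity_ofReal hνint.2
  have hdens : μ₁ + μ₂ = (torusHaar d).withDensity fun t => H t + ENNReal.ofReal C := by
    refine Measure.ext fun s hs => ?_
    rw [withDensity_apply _ hs, lintegral_add_right _ measurable_const, ← withDensity_apply _ hs,
      Measure.add_apply]
    congr 1
    · have hφ : Measurable (s.indicator (1 : UnitAddTorus (Fin d) → ℝ≥0∞)) :=
        measurable_one.indicator hs
      have h1 := lintegral_comp_torusPt_mul hL hfc.measurable hφ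
      simp only [hfH] at h1
      have h2 := lintegral_cube_comp_torusPt (d := d) hL (hφ.mul hH.measurable)
      simp only [Pi.mul_apply] at h2
      rw [h2] at h1
      have h3 : ∫⁻ t, s.indicator 1 t * H t ∂torusHaar d = (torusHaar d).withDensity H s := by
        rw [withDensity_apply _ hs, ← lintegral_indicator hs]
        refine lintegral_congr fun t => ?_
        by_cases ht : t ∈ s <;> simp [ht]
      have h4 : (volume.withDensity fun x => ENNReal.ofReal (f x)).map (torusPt d L) s
          = ∫⁻ x, s.indicator 1 (torusPt d L x) * ENNReal.ofReal (f x) := by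
        rw [Measure.map_apply hτ hs, withDensity_apply _ (hs.preimage hτ),
          ← lintegral_indicator (hs.preimage hτ)]
        refine lintegral_congr fun x => ?_
        by_cases hx : torusPt d L x ∈ s <;> simp [hx]
      simp only [μ₁, Measure.smul_apply, smul_eq_mul]
      rw [h4, h1, h3, ← mul_assoc, ← ENNReal.ofReal_mul (inv_nonneg.2 hLd.le),
        inv_mul_cancel₀ hLd.ne', ENNReal.ofReal_one, one_mul]
    · simp [μ₂]
  have hint : ∀ (κ : Measure (UnitAddTorus (Fin d))) [IsFiniteMeasure κ]
      (ψ : C(UnitAddTorus (Fin d), ℂ)), Integrable (fun t => ψ t) κ := fun κ _ ψ =>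
    (BoundedContinuousFunction.mkOfCompact ψ).integrable κ
  have hmeas : μ₁ + μ₂ = (torusHaar d).withDensity fun t => ENNReal.ofReal ((G t).re + C) := by
    refine measure_torus_ext fun n => ?_
    rw [integral_add_measure (hint μ₁ _) (hint μ₂ _)]
    have h1 : ∫ t, UnitAddTorus.mFourier n t ∂μ₁ = (c (-n) : ℂ) := by
      simp only [μ₁]
      rw [integral_smul_measure, integral_map hτ.aemeasurable (by fun_prop),
        integral_withDensity_eq_integral_toReal_smul hfc.measurable.ennreal_ofReal
          (ae_of_all _ fun x => ENNReal.ofReal_lt_top),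
        ENNReal.toReal_ofReal (inv_nonneg.2 hLd.le)]
      have h2 := hFT (-dualPt d L n)
      rw [Real.fourier_eq'] at h2
      simp only [hcdef, dualPt_neg, Complex.ofReal_mul]
      rw [← h2, Complex.real_smul]
      congr 1
      refine integral_congr_ae (ae_of_all _ fun x => ?_)
      simp only [mFourier_torusPt, ENNReal.toReal_ofReal (hf0 x), Complex.real_smul, smul_eq_mul]
      ring
    have h2 : ∫ t, UnitAddTorus.mFourier n t ∂μ₂
        = C * ∫ t, UnitAddTorus.mFourier n t ∂torusHaar d := by
      simp only [μ₂]
      rw [integral_smul_measure, ENNReal.toReal_ofReal hC0, Complex.real_smul]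
    have h3 : ∫ t, UnitAddTorus.mFourier n t * G t ∂torusHaar d = (c (-n) : ℂ) := by
      have h4 : HasSum (fun z => ∫ t, UnitAddTorus.mFourier n t *
          ((c z : ℂ) * UnitAddTorus.mFourier z t) ∂torusHaar d)
          (∫ t, ∑' z, UnitAddTorus.mFourier n t *
          ((c z : ℂ) * UnitAddTorus.mFourier z t) ∂torusHaar d) := by
        refine hasSum_integral_of_summable_integral_norm (fun z => ?_) ?_
        · exact hint (torusHaar d) (UnitAddTorus.mFourier n * (c z : ℂ) • UnitAddTorus.mFourier z)
        · simpa only [norm_mul _ ((_ : ℂ) * _), hnorm, norm_mFourier_apply, one_mul,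
            integral_const, probReal_univ, one_smul] using hcs
      have h5 : ∀ z, ∫ t, UnitAddTorus.mFourier n t *
          ((c z : ℂ) * UnitAddTorus.mFourier z t) ∂torusHaar d = if z = -n then (c z : ℂ) else 0 := by
        intro z
        have h6 : ∀ t, UnitAddTorus.mFourier n t * ((c z : ℂ) * UnitAddTorus.mFourier z t)
            = (c z : ℂ) * UnitAddTorus.mFourier (n + z) t := fun t => by
          rw [UnitAddTorus.mFourier_add]
          ring
        simp only [h6]
        rw [integral_const_mul, integral_mFourier]
        simp only [eq_neg_iff_add_eq_zero, add_comm n z]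
        split_ifs <;> simp
      simp only [h5, tsum_mul_left] at h4
      have h7 : HasSum (fun z => if z = -n then (c z : ℂ) else 0) (c (-n) : ℂ) := by
        refine (hasSum_ite_eq (-n) (c (-n) : ℂ)).congr_fun fun z => ?_
        split_ifs with hz <;> simp [hz]
      exact h4.unique h7
    have h4 : ∫ t, UnitAddTorus.mFourier n t
        ∂((torusHaar d).withDensity fun t => ENNReal.ofReal ((G t).re + C))
        = (c (-n) : ℂ) + C * ∫ t, UnitAddTorus.mFourier n t ∂torusHaar d := by
      rw [integral_withDensity_eq_integral_toReal_smul
        (hrec.add_const C).measurable.ennreal_ofReal (ae_of_all _ fun x => ENNReal.ofReal_lt_top),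
        ← h3, ← integral_const_mul, ← integral_add]
      · refine integral_congr_ae (ae_of_all _ fun t => ?_)
        simp only [ENNReal.toReal_ofReal (hGre t), Complex.real_smul]
        push_cast
        rw [hGreal]
        ring
      · exact hint (torusHaar d) (UnitAddTorus.mFourier n * ⟨G, hGc⟩)
      · exact (hint (torusHaar d) (UnitAddTorus.mFourier n)).const_mul _
    rw [h1, h2, h4]
  have hae : (fun t => H t + ENNReal.ofReal C) =ᵐ[torusHaar d]
      fun t => ENNReal.ofReal ((G t).re + C) := by
    rw [← withDensity_eq_iff_of_sigmaFinite (hH.measurable.add_const _).aemeasurable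
      (hrec.add_const C).measurable.ennreal_ofReal.aemeasurable, ← hdens, hmeas]
  have heq := (Continuous.ae_eq_iff_eq (torusHaar d) (hH.add continuous_const)
    (ENNReal.continuous_ofReal.comp (hrec.add_const C))).1 hae
  have heq' : ∀ t, H t + ENNReal.ofReal C = ENNReal.ofReal ((G t).re + C) := fun t => congrFun heq t
  have hG0 : ∀ t, 0 ≤ (G t).re := fun t => by
    have h1 : ENNReal.ofReal C ≤ ENNReal.ofReal ((G t).re + C) := by
      rw [← heq' t]; exact le_add_self
    have := (ENNReal.ofReal_le_ofReal_iff (hGre t)).1 h1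
    linarith
  refine ⟨fun t => (G t).re, hrec, hG0, fun t => ?_, hGreal⟩
  have h1 := heq' t
  rw [ENNReal.ofReal_add (hG0 t) hC0] at h1
  exact (ENNReal.add_left_inj ENNReal.ofReal_ne_top).1 h1

/-! ### Products of series and sums over invariant labellings -/

theorem prod_tsum_of_summable_norm_fin {ι R : Type*} [NormedCommRing R] [CompleteSpace R] (n : ℕ) :
    ∀ a : Fin n → ι → R, (∀ i, Summable fun z => ‖a i z‖) →
      (Summable fun κ : Fin n → ι => ‖∏ i, a i (κ i)‖) ∧
        ∏ i, ∑' z, a i z = ∑' κ : Fin n → ι, ∏ i, a i (κ i) := by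
  induction n with
  | zero =>
    intro a _
    exact ⟨summable_of_hasFiniteSupport (Set.toFinite _), by simp⟩
  | succ n ih =>
    intro a h
    obtain ⟨h1, h2⟩ := ih (fun i => a i.succ) fun i => h i.succ
    obtain ⟨e, he⟩ : ∃ e : ι × (Fin n → ι) ≃ (Fin (n + 1) → ι), ∀ p, e p = Fin.cons p.1 p.2 :=
      ⟨Fin.consEquiv fun _ => ι, fun _ => rfl⟩
    have key : ∀ p, ∏ i, a i (e p i) = a 0 p.1 * ∏ i : Fin n, a i.succ (p.2 i) := fun p => by
      simp [Fin.prod_univ_succ, he]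
    constructor
    · refine (e.summable_iff (f := fun κ : Fin (n + 1) → ι => ‖∏ i, a i (κ i)‖)).1 ?_
      refine ((h 0).mul_norm h1).congr fun p => ?_
      rw [Function.comp_apply, key]
    · rw [Fin.prod_univ_succ, h2, tsum_mul_tsum_of_summable_norm (h 0) h1,
        ← e.tsum_eq fun κ : Fin (n + 1) → ι => ∏ i, a i (κ i)]
      exact tsum_congr fun p => (key p).symm

theorem prod_tsum_of_summable_norm {I ι R : Type*} [Fintype I] [NormedCommRing R]
    [CompleteSpace R] {a : I → ι → R} (h : ∀ i, Summable fun z => ‖a i z‖) :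
    (Summable fun κ : I → ι => ‖∏ i, a i (κ i)‖) ∧
      ∏ i, ∑' z, a i z = ∑' κ : I → ι, ∏ i, a i (κ i) := by
  let e := Fintype.equivFin I
  obtain ⟨h1, h2⟩ := prod_tsum_of_summable_norm_fin (Fintype.card I) (fun i => a (e.symm i))
    fun i => h _
  obtain ⟨E, hE⟩ : ∃ E : (Fin (Fintype.card I) → ι) ≃ (I → ι), ∀ κ i, E κ i = κ (e i) :=
    ⟨e.symm.arrowCongr (Equiv.refl ι), fun _ _ => rfl⟩
  have key : ∀ κ, ∏ i, a i (E κ i) = ∏ i, a (e.symm i) (κ i) := fun κ => by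
    rw [← e.symm.prod_comp]
    exact Finset.prod_congr rfl fun i _ => by rw [hE, Equiv.apply_symm_apply]
  constructor
  · refine (E.summable_iff (f := fun κ : I → ι => ‖∏ i, a i (κ i)‖)).1 (h1.congr fun κ => ?_)
    rw [Function.comp_apply, key]
  · rw [← E.tsum_eq fun κ : I → ι => ∏ i, a i (κ i), ← e.symm.prod_comp, h2]
    exact tsum_congr fun κ => (key κ).symm

/-- The map sending a point to its cycle (or to itself if it is fixed). -/
def cycleMap {N : ℕ} (π : Equiv.Perm (Fin N)) (i : Fin N) :
    π.cycleFactorsFinset ⊕ {i // π i = i} :=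
  if h : π i = i then Sum.inr ⟨i, h⟩ else
    Sum.inl ⟨π.cycleOf i, Equiv.Perm.cycleOf_mem_cycleFactorsFinset_iff.2
      (Equiv.Perm.mem_support.2 h)⟩

theorem cycleMap_eq_inl_iff {N : ℕ} (π : Equiv.Perm (Fin N)) (i : Fin N)
    (c : π.cycleFactorsFinset) : cycleMap π i = Sum.inl c ↔ i ∈ c.1.support := by
  obtain ⟨c, hc⟩ := c
  unfold cycleMap
  split_ifs with h
  · simp only [false_iff]
    intro hi
    exact Equiv.Perm.mem_support.1 (Equiv.Perm.mem_cycleFactorsFinset_support_le hc hi) h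
  · simp only [Sum.inl.injEq, Subtype.mk.injEq]
    rw [← Equiv.Perm.eq_cycleOf_of_mem_cycleFactorsFinset_iff π c hc i, eq_comm]

theorem cycleMap_eq_inr_iff {N : ℕ} (π : Equiv.Perm (Fin N)) (i : Fin N)
    (c : {i // π i = i}) : cycleMap π i = Sum.inr c ↔ i = c.1 := by
  obtain ⟨c, hc⟩ := c
  unfold cycleMap
  split_ifs with h
  · simp
  · simp only [false_iff]
    rintro rfl
    exact h hc

theorem cycleMap_surjective {N : ℕ} (π : Equiv.Perm (Fin N)) :
    Function.Surjective (cycleMap π) := by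
  rintro (c | c)
  · obtain ⟨i, hi⟩ := (Equiv.Perm.mem_cycleFactorsFinset_iff.1 c.2).1.nonempty_support
    exact ⟨i, (cycleMap_eq_inl_iff π i c).2 hi⟩
  · exact ⟨c.1, (cycleMap_eq_inr_iff π c.1 c).2 rfl⟩

theorem cycleMap_apply_self {N : ℕ} (π : Equiv.Perm (Fin N)) (i : Fin N) :
    cycleMap π (π i) = cycleMap π i := by
  rcases h : cycleMap π i with c | c
  · rw [cycleMap_eq_inl_iff] at h ⊢
    rw [← (Equiv.Perm.mem_cycleFactorsFinset_iff.1 c.2).2 i h]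
    exact Equiv.Perm.apply_mem_support.2 h
  · rw [cycleMap_eq_inr_iff] at h ⊢
    rw [h, c.2]

theorem comp_perm_eq_iff_factorsThrough {N : ℕ} {ι : Type*} (π : Equiv.Perm (Fin N))
    (κ : Fin N → ι) : κ ∘ π = κ ↔ ∃ κ', κ = κ' ∘ cycleMap π := by
  constructor
  · intro h
    have hsame : ∀ i j, π.SameCycle i j → κ i = κ j := by
      rintro i j hij
      obtain ⟨n, rfl⟩ := hij.exists_nat_pow_eq
      induction n with
      | zero => rfl
      | succ n ih =>
        rw [pow_succ', Equiv.Perm.mul_apply]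
        rw [ih ⟨n, by simp⟩]
        exact (congrFun h _).symm
    have hfac : Function.FactorsThrough κ (cycleMap π) := by
      intro i j hij
      rcases h : cycleMap π j with c | c
      · have hi := (cycleMap_eq_inl_iff π i c).1 (hij.trans h)
        have hj := (cycleMap_eq_inl_iff π j c).1 h
        rw [Equiv.Perm.cycle_is_cycleOf hi c.2] at hj
        exact hsame _ _ (Equiv.Perm.mem_support_cycleOf_iff.1 hj).1
      · rw [(cycleMap_eq_inr_iff π i c).1 (hij.trans h), (cycleMap_eq_inr_iff π j c).1 h]
    exact ⟨κ ∘ Function.surjInv (cycleMap_surjective π), funext fun i =>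
      hfac (Function.surjInv_eq (cycleMap_surjective π) _).symm⟩
  · rintro ⟨κ', rfl⟩
    funext i
    simp [cycleMap_apply_self]

theorem prod_pow_cycCount {N : ℕ} {R : Type*} [CommMonoid R] (π : Equiv.Perm (Fin N)) (s : ℕ → R) :
    ∏ j ∈ Finset.Icc 1 N, s j ^ cycCount π j
      = ∏ q : π.cycleFactorsFinset ⊕ {i // π i = i},
          s (Finset.univ.filter fun i => cycleMap π i = q).card := by
  have h1 : ∏ j ∈ Finset.Icc 1 N, s j ^ cycCount π j = ((cyclePartition π).parts.map s).prod := by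
    rw [Finset.prod_multiset_map_count]
    refine (Finset.prod_subset (fun j hj => ?_) fun j _ hj => ?_).symm.trans
      (Finset.prod_congr rfl fun j _ => by rw [← cycCount_eq_count])
    · rw [Multiset.mem_toFinset] at hj
      exact Finset.mem_Icc.2 ⟨(cyclePartition π).parts_pos hj,
        ((Multiset.le_sum_of_mem hj).trans_eq (cyclePartition π).parts_sum)⟩
    · rw [Multiset.mem_toFinset] at hj
      simp [Multiset.count_eq_zero.2 hj, cycCount_eq_count]
  rw [h1, Fintype.prod_sum_type]
  simp only [cycleMap_eq_inl_iff, cycleMap_eq_inr_iff, cyclePartition, Multiset.map_add,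
    Multiset.prod_add, Multiset.map_replicate, Multiset.prod_replicate]
  congr 1
  · rw [Equiv.Perm.cycleType_def, Multiset.map_map]
    change ∏ c ∈ π.cycleFactorsFinset, s c.support.card = _
    rw [← Finset.prod_coe_sort]
    refine Finset.prod_congr rfl fun c _ => ?_
    congr 2
    ext i
    simp
  · simp only [Finset.filter_eq', Finset.mem_univ, if_true, Finset.card_singleton,
      Finset.prod_const, Finset.card_univ]
    congr 1
    have h2 := Equiv.Perm.sum_cycleType π
    rw [h2, Fintype.card_subtype]
    have h3 : π.support = Finset.univ.filter fun i => ¬ π i = i := by ext i; simp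
    have h4 := Finset.card_filter_add_card_filter_not (s := (Finset.univ : Finset (Fin N)))
      (fun i => π i = i)
    rw [Finset.card_univ, Fintype.card_fin] at h4
    rw [h3]
    omega

/-- The sum of `∏ g(κ_i)` over labellings `κ` invariant under `π` factorizes over the cycles. -/
theorem tsum_invariant_eq_prod_cycCount {N : ℕ} {ι : Type*} (π : Equiv.Perm (Fin N)) (g : ι → ℂ)
    (hg : Summable fun z => ‖g z‖) (hg1 : ∀ z, ‖g z‖ ≤ 1) [∀ κ : Fin N → ι, Decidable (κ ∘ π = κ)] :
    ∑' κ : Fin N → ι, (if κ ∘ π = κ then ∏ i, g (κ i) else 0)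
      = ∏ j ∈ Finset.Icc 1 N, (∑' z, g z ^ j) ^ cycCount π j := by
  have hcard : ∀ q, (Finset.univ.filter fun i => cycleMap π i = q).card ≠ 0 := fun q => by
    obtain ⟨i, hi⟩ := cycleMap_surjective π q
    exact Finset.card_ne_zero_of_mem (Finset.mem_filter.2 ⟨Finset.mem_univ i, hi⟩)
  have hsum : ∀ n, n ≠ 0 → Summable fun z => ‖g z ^ n‖ := fun n hn => by
    refine Summable.of_nonneg_of_le (fun z => norm_nonneg _) (fun z => ?_) hg
    rw [norm_pow]
    exact pow_le_of_le_one (norm_nonneg _) (hg1 z) hn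
  rw [prod_pow_cycCount π fun j => ∑' z, g z ^ j,
    (prod_tsum_of_summable_norm fun q => hsum _ (hcard q)).2]
  have hinj : Function.Injective fun κ' : π.cycleFactorsFinset ⊕ {i // π i = i} → ι =>
      κ' ∘ cycleMap π := (cycleMap_surjective π).injective_comp_right
  rw [← hinj.tsum_eq]
  · refine tsum_congr fun κ' => ?_
    rw [if_pos ((comp_perm_eq_iff_factorsThrough π _).2 ⟨κ', rfl⟩)]
    rw [← Finset.prod_fiberwise Finset.univ (cycleMap π)]
    refine Finset.prod_congr rfl fun q _ => ?_
    rw [Finset.prod_congr rfl (g := fun _ => g (κ' q)), Finset.prod_const]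
    intro i hi
    simp [(Finset.mem_filter.1 hi).2]
  · intro κ hκ
    by_contra h
    exact hκ (if_neg fun h' => h (((comp_perm_eq_iff_factorsThrough π κ).1 h').imp
      fun _ => Eq.symm))

theorem mFourier_sub_apply {d : ℕ} (n : Fin d → ℤ) (s t : UnitAddTorus (Fin d)) :
    UnitAddTorus.mFourier n (s - t)
      = UnitAddTorus.mFourier n s * UnitAddTorus.mFourier (-n) t := by
  simp only [UnitAddTorus.mFourier, ContinuousMap.coe_mk, ← Finset.prod_mul_distrib]
  refine Finset.prod_congr rfl fun i _ => ?_
  simp only [fourier_apply, Pi.sub_apply, Pi.neg_apply, sub_eq_add_neg, smul_add,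
    AddCircle.toCircle_add, Circle.coe_mul, smul_neg, neg_smul]

theorem integral_prod_mFourier_sub {d N : ℕ} (π : Equiv.Perm (Fin N))
    (κ : Fin N → Fin d → ℤ) [Decidable (κ ∘ π = κ)] :
    ∫ t : Fin N → UnitAddTorus (Fin d), ∏ i, UnitAddTorus.mFourier (κ i) (t i - t (π i))
        ∂Measure.pi (fun _ => torusHaar d) = if κ ∘ π = κ then 1 else 0 := by
  have h1 : ∀ t : Fin N → UnitAddTorus (Fin d),
      ∏ i, UnitAddTorus.mFourier (κ i) (t i - t (π i))
        = ∏ i, UnitAddTorus.mFourier (κ i - κ (π.symm i)) (t i) := fun t => by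
    simp only [mFourier_sub_apply, Finset.prod_mul_distrib]
    rw [← Equiv.prod_comp π.symm fun i => UnitAddTorus.mFourier (-κ i) (t (π i)),
      ← Finset.prod_mul_distrib]
    refine Finset.prod_congr rfl fun i _ => ?_
    rw [π.apply_symm_apply, sub_eq_add_neg, UnitAddTorus.mFourier_add]
  simp only [h1]
  rw [integral_fintype_prod_eq_prod]
  simp only [integral_mFourier, sub_eq_zero]
  have h2 : κ ∘ π = κ ↔ ∀ i, κ i = κ (π.symm i) := by
    constructor
    · intro h i
      have := congrFun h (π.symm i)
      simpa using this
    · intro h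
      funext i
      simpa using h (π i)
  split_ifs with h
  · exact Finset.prod_eq_one fun i _ => if_pos (h2.1 h i)
  · rw [h2] at h
    push Not at h
    obtain ⟨i, hi⟩ := h
    exact Finset.prod_eq_zero (Finset.mem_univ i) (if_neg hi)

theorem integral_prod_eq_tsum {d N : ℕ} (π : Equiv.Perm (Fin N))
    [∀ κ : Fin N → Fin d → ℤ, Decidable (κ ∘ π = κ)] {c : (Fin d → ℤ) → ℝ} (hc0 : ∀ z, 0 ≤ c z)
    (hc : Summable c) {h : UnitAddTorus (Fin d) → ℝ}
    (hh : ∀ t, (h t : ℂ) = ∑' z, (c z : ℂ) * UnitAddTorus.mFourier z t) :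
    ∫ t : Fin N → UnitAddTorus (Fin d), ∏ i, (h (t i - t (π i)) : ℂ)
        ∂Measure.pi (fun _ => torusHaar d)
      = ∑' κ : Fin N → Fin d → ℤ, if κ ∘ π = κ then ∏ i, (c (κ i) : ℂ) else 0 := by
  have hnorm : ∀ z t, ‖(c z : ℂ) * UnitAddTorus.mFourier z t‖ = c z := fun z t => by
    rw [norm_mul, norm_mFourier_apply, mul_one, Complex.norm_real, Real.norm_eq_abs,
      abs_of_nonneg (hc0 z)]
  have hcn : Summable fun z => ‖(c z : ℂ)‖ := by
    simpa only [Complex.norm_real, Real.norm_eq_abs, abs_of_nonneg (hc0 _)] using hc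
  have h1 : ∀ t : Fin N → UnitAddTorus (Fin d), ∏ i, (h (t i - t (π i)) : ℂ)
      = ∑' κ : Fin N → Fin d → ℤ,
        ∏ i, ((c (κ i) : ℂ) * UnitAddTorus.mFourier (κ i) (t i - t (π i))) := fun t => by
    simp only [hh]
    exact (prod_tsum_of_summable_norm
      (a := fun i z => (c z : ℂ) * UnitAddTorus.mFourier z (t i - t (π i)))
      fun i => by simpa only [hnorm] using hc).2
  simp only [h1]
  have hcont : ∀ κ : Fin N → Fin d → ℤ, Continuous fun t : Fin N → UnitAddTorus (Fin d) =>
      ∏ i, ((c (κ i) : ℂ) * UnitAddTorus.mFourier (κ i) (t i - t (π i))) := fun κ => by fun_prop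
  have hP : HasSum (fun κ : Fin N → Fin d → ℤ => ∫ t : Fin N → UnitAddTorus (Fin d),
        ∏ i, ((c (κ i) : ℂ) * UnitAddTorus.mFourier (κ i) (t i - t (π i)))
        ∂Measure.pi (fun _ => torusHaar d)) (∫ t : Fin N → UnitAddTorus (Fin d),
        ∑' κ : Fin N → Fin d → ℤ,
        ∏ i, ((c (κ i) : ℂ) * UnitAddTorus.mFourier (κ i) (t i - t (π i)))
        ∂Measure.pi (fun _ => torusHaar d)) := by
    refine hasSum_integral_of_summable_integral_norm (fun κ => ?_) ?_
    · exact (BoundedContinuousFunction.mkOfCompact ⟨_, hcont κ⟩).integrable _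
    · simp only [norm_prod, hnorm, integral_const, probReal_univ, one_smul]
      refine ((prod_tsum_of_summable_norm (I := Fin N) fun _ => hcn).1).congr fun κ => ?_
      rw [norm_prod]
      simp only [Complex.norm_real, Real.norm_eq_abs, abs_of_nonneg (hc0 _)]
  rw [← hP.tsum_eq]
  refine tsum_congr fun κ => ?_
  simp only [Finset.prod_mul_distrib]
  rw [integral_const_mul, integral_prod_mFourier_sub]
  split_ifs <;> simp

/-! ### The Gibbs weight of a permutation -/

theorem pi_const_smul {I X : Type*} [Fintype I] [MeasurableSpace X] (μ : Measure X)
    [IsFiniteMeasure μ] (c : ℝ≥0∞) (hc : c ≠ ∞) :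
    Measure.pi (fun _ : I => c • μ) = c ^ Fintype.card I • Measure.pi fun _ : I => μ := by
  have : IsFiniteMeasure (c • μ) := Measure.smul_finite _ hc
  refine Measure.pi_eq fun s _ => ?_
  rw [Measure.smul_apply, Measure.pi_pi]
  simp [Finset.prod_mul_distrib]

theorem lintegral_cube_pi {d N : ℕ} {L : ℝ} (hL : 0 < L)
    {F : (Fin N → UnitAddTorus (Fin d)) → ℝ≥0∞} (hF : Measurable F) :
    ∫⁻ x in Set.univ.pi (fun _ : Fin N => cube d L), F (fun i => torusPt d L (x i))
      = ENNReal.ofReal ((L ^ d) ^ N) * ∫⁻ t, F t ∂Measure.pi fun _ => torusHaar d := by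
  have hfin : IsFiniteMeasure (ENNReal.ofReal (L ^ d) • torusHaar d) :=
    Measure.smul_finite _ ENNReal.ofReal_ne_top
  have h1 := (measurePreserving_pi (fun _ : Fin N => volume.restrict (cube d L))
    (fun _ => ENNReal.ofReal (L ^ d) • torusHaar d)
    fun _ => measurePreserving_torusPt hL).lintegral_comp hF
  rw [volume_pi, Measure.restrict_pi_pi, h1, pi_const_smul _ _ ENNReal.ofReal_ne_top,
    lintegral_smul_measure, Fintype.card_fin, smul_eq_mul,
    ENNReal.ofReal_pow (pow_nonneg hL.le d)]

theorem toReal_gibbsW {d : ℕ} {L : ℝ} (hL : 0 < L) {f g : Eu d → ℝ}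
    (hf : Integrable f) (hfc : Continuous f) (hf0 : ∀ x, 0 ≤ f x)
    (hFT : ∀ k, 𝓕 (fun x => (f x : ℂ)) k = (g k : ℂ)) (hg0 : ∀ k, 0 ≤ g k) (hg1 : ∀ k, g k ≤ 1)
    (hs : Summable fun z => g (dualPt d L z)) (hc : Continuous (fper d f L))
    (α : ℕ → ℝ) {N : ℕ} (π : Equiv.Perm (Fin N)) :
    (gibbsW d f α L N π).toReal = permWeight α π *
      ∏ j ∈ Finset.Icc 1 N, (∑' z, g (dualPt d L z) ^ j) ^ cycCount π j := by
  classical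
  have hLd : 0 < L ^ d := by positivity
  obtain ⟨H, hH, hfH⟩ := exists_fper_eq_comp hL.ne' hc
  obtain ⟨h, hhc, hh0, hHh, hh⟩ := exists_periodization_eq hL hf hfc hf0 hFT hg0 hs hH hfH
  have hcont : Continuous fun t : Fin N → UnitAddTorus (Fin d) => ∏ i, h (t i - t (π i)) := by
    fun_prop
  have hint : ∫ t : Fin N → UnitAddTorus (Fin d), ∏ i, h (t i - t (π i))
      ∂Measure.pi (fun _ => torusHaar d) = ((L ^ d) ^ N)⁻¹ *
        ∏ j ∈ Finset.Icc 1 N, (∑' z, g (dualPt d L z) ^ j) ^ cycCount π j := by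
    have h1 := integral_prod_eq_tsum π
      (fun z => mul_nonneg (inv_nonneg.2 hLd.le) (hg0 (dualPt d L z))) (hs.mul_left _) hh
    have h2 := tsum_invariant_eq_prod_cycCount π (fun z => (g (dualPt d L z) : ℂ))
      (by simpa only [Complex.norm_real, Real.norm_eq_abs, abs_of_nonneg (hg0 _)] using hs)
      (fun z => by
        simpa only [Complex.norm_real, Real.norm_eq_abs, abs_of_nonneg (hg0 _)] using hg1 _)
    have h3 : ∀ κ : Fin N → Fin d → ℤ,
        (if κ ∘ π = κ then ∏ i, (((L ^ d)⁻¹ * g (dualPt d L (κ i)) : ℝ) : ℂ) else 0)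
        = (((L ^ d) ^ N)⁻¹ : ℝ) *
          if κ ∘ π = κ then ∏ i, (g (dualPt d L (κ i)) : ℂ) else 0 := fun κ => by
      split_ifs <;> simp [Finset.prod_mul_distrib]
    simp only [h3] at h1
    rw [tsum_mul_left, h2] at h1
    have h4 : ∀ j, (∑' z, (g (dualPt d L z) : ℂ) ^ j)
        = ((∑' z, g (dualPt d L z) ^ j : ℝ) : ℂ) := fun j => by
      rw [Complex.ofReal_tsum]
      push_cast
      rfl
    simp only [h4] at h1
    rw [← Complex.ofReal_inj, ← integral_complex_ofReal]
    push_cast at h1 ⊢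
    exact h1
  have hlint : ∫⁻ x in Set.univ.pi (fun _ : Fin N => cube d L), ∏ i, fper d f L (x i - x (π i))
      = ENNReal.ofReal (∏ j ∈ Finset.Icc 1 N,
        (∑' z, g (dualPt d L z) ^ j) ^ cycCount π j) := by
    have h1 := lintegral_cube_pi (N := N) hL (F := fun t => ENNReal.ofReal
      (∏ i, h (t i - t (π i)))) hcont.measurable.ennreal_ofReal
    have h2 : ∀ x : Fin N → Eu d, ∏ i, fper d f L (x i - x (π i))
        = ENNReal.ofReal (∏ i, h (torusPt d L (x i) - torusPt d L (x (π i)))) := fun x => by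
      rw [ENNReal.ofReal_prod_of_nonneg fun i _ => hh0 _]
      simp only [hfH, hHh, torusPt_sub]
    simp only [h2]
    rw [h1, ← ofReal_integral_eq_lintegral_ofReal, hint, ← ENNReal.ofReal_mul (by positivity),
      mul_inv_cancel_left₀ (by positivity)]
    · exact (BoundedContinuousFunction.mkOfCompact ⟨_, hcont⟩).integrable _
    · exact ae_of_all _ fun t => Finset.prod_nonneg fun i _ => hh0 _
  rw [gibbsW, hlint, ENNReal.toReal_mul, ENNReal.toReal_ofReal (show 0 ≤ permWeight α π from
    (Real.exp_pos _).le), ENNReal.toReal_ofReal]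
  exact Finset.prod_nonneg fun j _ => pow_nonneg (tsum_nonneg fun z => pow_nonneg (hg0 _) _) _

theorem permWeight_mul_prod {N : ℕ} (α s : ℕ → ℝ) (π : Equiv.Perm (Fin N)) :
    permWeight α π * ∏ j ∈ Finset.Icc 1 N, s j ^ cycCount π j
      = cycWeight (fun j => if j = 0 then 0 else Real.exp (-α j) * s j) π := by
  rw [permWeight, cycWeight, ← Finset.sum_neg_distrib, Real.exp_sum, ← Finset.prod_mul_distrib]
  refine Finset.prod_congr rfl fun j hj => ?_
  rw [if_neg (by have := (Finset.mem_Icc.1 hj).1; omega), mul_pow, ← Real.exp_nat_mul]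
  congr 2
  ring

/-! ### The thermodynamic limit of the spatial model -/

/-- The effective cycle weights `θ_j = e^{-α_j} ∑_{k ∈ Λ*} g(k)^j` in the cube of side `L`. -/
def latticeWeight (d : ℕ) (g : Eu d → ℝ) (α : ℕ → ℝ) (L : ℝ) (j : ℕ) : ℝ :=
  if j = 0 then 0 else Real.exp (-α j) * ∑' z : Fin d → ℤ, g (dualPt d L z) ^ j

/-- The densities `q_j = e^{-α_j} ∫ g(k)^j dk`. -/
def cycleDensity (d : ℕ) (g : Eu d → ℝ) (α : ℕ → ℝ) (j : ℕ) : ℝ :=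
  if j = 0 then 0 else Real.exp (-α j) * ∫ k : Eu d, g k ^ j

theorem integral_pos_of_forall_pos {d : ℕ} {g : Eu d → ℝ} (hg0 : ∀ k, 0 < g k)
    (hint : Integrable g) : 0 < ∫ k, g k := by
  rw [integral_pos_iff_support_of_nonneg (fun x => (hg0 x).le) hint,
    show Function.support g = Set.univ from Set.eq_univ_of_forall fun x => (hg0 x).ne']
  exact isOpen_univ.measure_pos volume Set.univ_nonempty

theorem exists_exp_neg_bounds {α : ℕ → ℝ} {l : ℝ} (hα : Tendsto α atTop (𝓝 l)) :
    ∃ c A : ℝ, 0 < c ∧ c ≤ 1 ∧ 0 < A ∧ (∀ j, c ≤ Real.exp (-α j)) ∧ ∀ j, Real.exp (-α j) ≤ A := by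
  obtain ⟨B, hB⟩ := hα.bddAbove_range
  obtain ⟨b, hb⟩ := hα.bddBelow_range
  refine ⟨min 1 (Real.exp (-B)), Real.exp (-b), lt_min one_pos (Real.exp_pos _), min_le_left _ _,
    Real.exp_pos _, fun j => (min_le_right _ _).trans ?_, fun j => ?_⟩
  · exact Real.exp_le_exp.2 (neg_le_neg (hB ⟨j, rfl⟩))
  · exact Real.exp_le_exp.2 (neg_le_neg (hb ⟨j, rfl⟩))

theorem exists_isThermo {d : ℕ} (hd : 1 ≤ d) {g : Eu d → ℝ} (hgc : Continuous g)
    (hg0 : ∀ k, 0 < g k) (hg1 : ∀ k, g k ≤ 1) (hg00 : g 0 = 1) (hint : Integrable g)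
    (hI : Summable fun j : ℕ => ∫ k, g k ^ (j + 1)) {α : ℕ → ℝ} {l : ℝ}
    (hα : Tendsto α atTop (𝓝 l)) {Ls : ℕ → ℝ} (hLs : Tendsto Ls atTop atTop)
    (hs : ∀ᶠ m in atTop, Summable fun z => g (dualPt d (Ls m) z))
    (hlim : Tendsto (fun m => (Ls m ^ d)⁻¹ * ∑' z, g (dualPt d (Ls m) z)) atTop
      (𝓝 (∫ x, g x))) :
    ∃ c C, IsThermo (fun m => Ls m ^ d) (fun m => latticeWeight d g α (Ls m))
      (cycleDensity d g α) c C := by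
  obtain ⟨c, A, hc0, hc1, hA, hc, hAle⟩ := exists_exp_neg_bounds hα
  have hpow : ∀ j ≠ 0, ∀ k, g k ^ j ≤ g k := fun j hj k =>
    pow_le_of_le_one (hg0 k).le (hg1 k) hj
  have hV : Tendsto (fun m => Ls m ^ d) atTop atTop :=
    (tendsto_pow_atTop (by omega)).comp hLs
  refine ⟨c, A * ((∫ x, g x) + 1), hV, fun m => if_pos rfl, hc0, hc1, ?_, ?_, fun j => ?_, ?_, ?_⟩
  · filter_upwards [hs] with m hm j hj
    have hm' : Summable fun z => g (dualPt d (Ls m) z) ^ j :=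
      Summable.of_nonneg_of_le (fun z => pow_nonneg (hg0 _).le j) (fun z => hpow j (by omega) _) hm
    have h0 : dualPt d (Ls m) 0 = 0 := by
      ext i
      simp [dualPt]
    have h1 : 1 ≤ ∑' z, g (dualPt d (Ls m) z) ^ j := by
      have := hm'.le_tsum 0 fun z _ => pow_nonneg (hg0 _).le j
      rwa [h0, hg00, one_pow] at this
    rw [latticeWeight, if_neg (by omega)]
    calc c = c * 1 := (mul_one c).symm
      _ ≤ _ := mul_le_mul (hc j) h1 zero_le_one (Real.exp_pos _).le
  · filter_upwards [hs, hlim.eventually_lt_const (lt_add_one _), hV.eventually_gt_atTop 0]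
      with m hm hlt hVm j
    have h1 : ∑' z, g (dualPt d (Ls m) z) ≤ ((∫ x, g x) + 1) * Ls m ^ d := by
      rw [inv_mul_lt_iff₀ hVm] at hlt
      linarith
    have h0 : 0 ≤ ∑' z, g (dualPt d (Ls m) z) := tsum_nonneg fun z => (hg0 _).le
    rw [latticeWeight, mul_assoc]
    split_ifs with hj
    · exact mul_nonneg hA.le (h0.trans h1)
    · refine mul_le_mul (hAle j) (le_trans ?_ h1)
        (tsum_nonneg fun z => pow_nonneg (hg0 _).le j) hA.le
      exact Summable.tsum_le_tsum (fun z => hpow j hj _) (Summable.of_nonneg_of_le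
        (fun z => pow_nonneg (hg0 _).le j) (fun z => hpow j hj _) hm) hm
  · by_cases hj : j = 0
    · simp [latticeWeight, cycleDensity, hj]
    · have h1 := (tendsto_riemannSum_of_le hgc (hgc.pow j) (fun x => pow_nonneg (hg0 x).le j)
        (hpow j hj) hint hLs hs hlim).const_mul (Real.exp (-α j))
      simp only [latticeWeight, cycleDensity, if_neg hj]
      refine h1.congr fun m => ?_
      simp only [Pi.pow_apply]
      ring
  · have h1 := integral_pos_of_forall_pos hg0 hint
    simp only [cycleDensity, one_ne_zero, if_false, pow_one]
    positivity
  · rw [← summable_nat_add_iff 1]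
    refine Summable.of_nonneg_of_le (fun j => ?_) (fun j => ?_) (hI.mul_left A)
    · simp only [cycleDensity, Nat.add_eq_zero_iff, one_ne_zero, and_false, if_false]
      exact mul_nonneg (Real.exp_pos _).le (integral_nonneg fun k => pow_nonneg (hg0 k).le _)
    · simp only [cycleDensity, Nat.add_eq_zero_iff, one_ne_zero, and_false, if_false]
      exact mul_le_mul_of_nonneg_right (hAle _)
        (integral_nonneg fun k => pow_nonneg (hg0 k).le _)

/-- The limit of the expected fraction of points in cycles longer than `K`. -/
theorem tendsto_longFraction {V : ℕ → ℝ} {θ : ℕ → ℕ → ℝ} {q : ℕ → ℝ} {c C : ℝ}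
    (T : IsThermo V θ q c C) {ρ : ℝ} (hρ : 0 < ρ) {N : ℕ → ℕ} (hN : ∀ m, (N m : ℝ) = ρ * V m)
    {z₀ : ℝ} (hz0 : 0 < z₀) (hz1 : z₀ ≤ 1) (hle : ∑' j, q j * z₀ ^ j ≤ ρ)
    (hlog : (ρ - ∑' j, q j * z₀ ^ j) * Real.log z₀ = 0) (K : ℕ) :
    Tendsto (fun m => (∑ π : Equiv.Perm (Fin (N m)), cycWeight (θ m) π *
        ((∑ j ∈ Finset.Icc (K + 1) (N m), (j : ℝ) * cycCount π j) / N m)) /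
        ∑ π : Equiv.Perm (Fin (N m)), cycWeight (θ m) π) atTop
      (𝓝 (1 - (∑ j ∈ Finset.Icc 1 K, q j * z₀ ^ j) / ρ)) := by
  have h1 := ((T.tendsto_meanShort_div hρ hN hz0 hz1 hle hlog K).div_const ρ).const_sub 1
  refine h1.congr' ?_
  have hNt : Tendsto (fun m => (N m : ℝ)) atTop atTop := by
    simp only [hN]
    exact T.volume_tendsto.const_mul_atTop hρ
  filter_upwards [T.le_theta, hNt.eventually_gt_atTop 0, hNt.eventually_ge_atTop (K : ℝ)]
    with m hθ hN0 hNK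
  have hNK' : K ≤ N m := by exact_mod_cast hNK
  have hpos : ∀ π : Equiv.Perm (Fin (N m)), 0 < cycWeight (θ m) π := fun π =>
    Finset.prod_pos fun j hj => pow_pos (T.c_pos.trans_le (hθ j (Finset.mem_Icc.1 hj).1)) _
  have hZ : 0 < ∑ π : Equiv.Perm (Fin (N m)), cycWeight (θ m) π :=
    Finset.sum_pos (fun π _ => hpos π) Finset.univ_nonempty
  have hsplit : ∀ π : Equiv.Perm (Fin (N m)),
      (∑ j ∈ Finset.Icc (K + 1) (N m), (j : ℝ) * cycCount π j) / N m
        = 1 - (∑ j ∈ Finset.Icc 1 K, (j : ℝ) * cycCount π j) / N m := fun π => by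
    have h2 : (∑ j ∈ Finset.Icc 1 (N m), (j : ℝ) * cycCount π j) = N m := by
      exact_mod_cast sum_mul_cycCount π
    have h3 : (∑ j ∈ Finset.Icc 1 K, (j : ℝ) * cycCount π j) +
        ∑ j ∈ Finset.Icc (K + 1) (N m), (j : ℝ) * cycCount π j = N m := by
      rw [← h2, ← Finset.sum_union]
      · congr 1
        ext j
        simp only [Finset.mem_union, Finset.mem_Icc]
        omega
      · exact Finset.disjoint_left.2 fun j hj hj' => by
          simp only [Finset.mem_Icc] at hj hj'
          omega
    field_simp
    linarith
  simp only [hsplit, mul_sub, mul_one, Finset.sum_sub_distrib, mul_div_assoc']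
  rw [← Finset.sum_div, sub_div, div_self hZ.ne', meanShort]
  simp only [div_div]
  rw [hN]
  congr 2
  ring

/-- Theorem 2.1 (a): under the stated assumptions on `ξ`, `ε` and the
cycle weights (`α_j → α > 0` with `∑_j |α_j - α| < ∞`, or `α_j → α ≤ 0` with
`∑_j j⁻¹|α_j - α| < ∞`), for any density `ρ > 0`, the fraction of points in infinite
cycles is `ν = lim_{K→∞} ν_K = max(0, 1 - ρ_c/ρ)`, where
`ν_K = liminf_{|Λ|,N→∞} E(N⁻¹ ∑_{i : ℓ⁽ⁱ⁾ > K} ℓ⁽ⁱ⁾)` along the thermodynamic limit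
with fixed density `ρ = N/|Λ|`. -/
theorem statement0
    (d : ℕ) (hd : 1 ≤ d) (f ε : Eu d → ℝ) (α : ℕ → ℝ)
    -- assumptions on the jump function `f = e^{-ξ}`
    (hf_cont : Continuous f) (hf_nonneg : ∀ x, 0 ≤ f x)
    (hf_norm : ∫ x : Eu d, f x = 1)
    -- the Fourier transform of `e^{-ξ}` is the positive function `e^{-ε}`
    (hFT : ∀ k : Eu d, 𝓕 (fun x => (f x : ℂ)) k = (Real.exp (-ε k) : ℂ))
    -- assumptions on the dispersion relation `ε`
    (hε_nonneg : ∀ k, 0 ≤ ε k)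
    (hε_uc : UniformContinuous fun k => Real.exp (-ε k))
    (hε_low : ∃ a > (0:ℝ), ∃ η : ℝ, 0 < η ∧ η < d ∧
      ∀ k : Eu d, ‖k‖ ≤ 1 → a * ‖k‖ ^ η ≤ ε k)
    (hε_pos : ∀ δ : ℝ, 0 < δ → ∃ c > (0:ℝ), ∀ k : Eu d, δ ≤ ‖k‖ → c ≤ ε k)
    -- the periodization `e^{-ξ_Λ}` is continuous for all large `L`
    (hper_cont : ∃ L₀ : ℝ, ∀ L ≥ L₀, Continuous (fper d f L))
    -- convergence of the Riemann sums `|Λ|⁻¹ ∑_{k∈Λ*} e^{-ε(k)} → ∫ e^{-ε(k)} dk`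
    (hRiemann : Tendsto
      (fun L : ℝ => (L ^ d)⁻¹ * ∑' z : Fin d → ℤ, Real.exp (-ε (dualPt d L z)))
      atTop (𝓝 (∫ k : Eu d, Real.exp (-ε k))))
    -- assumptions on the cycle weights
    (αlim : ℝ) (hα_lim : Tendsto (fun j : ℕ => α j) atTop (𝓝 αlim))
    (hα_case : (0 < αlim ∧ Summable fun j : ℕ => |α j - αlim|) ∨
      (αlim ≤ 0 ∧ Summable fun j : ℕ => |α j - αlim| / j))
    -- thermodynamic limit at fixed density `ρ > 0`
    (ρ : ℝ) (hρ : 0 < ρ) (Ls : ℕ → ℝ) (Ns : ℕ → ℕ)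
    (hLs : Tendsto Ls atTop atTop)
    (hfix : ∀ m, (Ns m : ℝ) = ρ * Ls m ^ d) :
    Tendsto (fun K : ℕ =>
        Filter.liminf (fun m => gibbsE d f α (Ls m) (Ns m)
          (fun π => (∑ j ∈ Finset.Icc (K+1) (Ns m), (j : ℝ) * cycCount π j) / (Ns m)))
          atTop)
      atTop (𝓝 (max 0 (1 - rhoC d ε α / ρ))) := by
  classical
  set g : Eu d → ℝ := fun k => Real.exp (-ε k) with hg
  have hg0 : ∀ k, 0 < g k := fun k => Real.exp_pos _
  have hg1 : ∀ k, g k ≤ 1 := fun k => Real.exp_le_one_iff.2 (neg_nonpos.2 (hε_nonneg k))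
  have hgc : Continuous g := hε_uc.continuous
  have hf_int : Integrable f := by
    by_contra h
    rw [integral_undef h] at hf_norm
    exact zero_ne_one hf_norm
  have hFTg : ∀ k, 𝓕 (fun x => (f x : ℂ)) k = (g k : ℂ) := hFT
  have hg00 : g 0 = 1 := by
    have h := hFTg 0
    rw [Real.fourier_eq'] at h
    simp only [inner_zero_right, mul_zero, Complex.ofReal_zero, zero_mul, Complex.exp_zero,
      one_smul] at h
    rw [integral_complex_ofReal, hf_norm] at h
    exact_mod_cast h.symm
  have hg_int : Integrable g :=
    integrable_of_fourier_eq hf_int hf_cont (fun k => (hg0 k).le) hg1 hgc hFTg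
  have hI : Summable fun j : ℕ => ∫ k, g k ^ (j + 1) :=
    summable_integral_exp_neg_pow hε_nonneg hgc hg_int hε_low hε_pos
  have hlim := hRiemann.comp hLs
  have hg_pos := integral_pos_of_forall_pos hg0 hg_int
  have hs : ∀ᶠ m in atTop, Summable fun z => g (dualPt d (Ls m) z) := by
    filter_upwards [hlim.eventually_const_lt hg_pos] with m hm
    by_contra h
    simp only [Function.comp_apply] at hm
    rw [tsum_eq_zero_of_not_summable h, mul_zero] at hm
    exact lt_irrefl _ hm
  obtain ⟨c, C, T⟩ := exists_isThermo hd hgc hg0 hg1 hg00 hg_int hI hα_lim hLs hs hlim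
  set q := cycleDensity d g α with hq
  obtain ⟨z₀, hz0, hz1, hz, hlog⟩ := exists_fugacity T.q_nonneg T.q_zero T.q_summable hρ
  have hrho : rhoC d ε α = ∑' j, q j := by
    rw [T.q_summable.tsum_eq_zero_add, T.q_zero, zero_add, rhoC]
    refine tsum_congr fun j => ?_
    rw [hq, cycleDensity, if_neg (Nat.succ_ne_zero j)]
    congr 1
    refine integral_congr_ae (ae_of_all _ fun k => ?_)
    simp only [hg, ← Real.exp_nat_mul]
    congr 1
    push_cast
    ring
  obtain ⟨L₀, hL₀⟩ := hper_cont
  have hlimK : ∀ K : ℕ, Filter.liminf (fun m => gibbsE d f α (Ls m) (Ns m)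
      (fun π => (∑ j ∈ Finset.Icc (K+1) (Ns m), (j : ℝ) * cycCount π j) / (Ns m))) atTop
      = 1 - (∑ j ∈ Finset.Icc 1 K, q j * z₀ ^ j) / ρ := fun K => by
    refine Tendsto.liminf_eq ((tendsto_longFraction T hρ hfix hz0 hz1
      (hz.trans_le (min_le_left _ _)) hlog K).congr' ?_)
    filter_upwards [hs, hLs.eventually_gt_atTop 0, hLs.eventually_ge_atTop L₀] with m hm hm0 hmL
    have hW : ∀ π : Equiv.Perm (Fin (Ns m)), (gibbsW d f α (Ls m) (Ns m) π).toReal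
        = cycWeight (latticeWeight d g α (Ls m)) π := fun π => by
      rw [toReal_gibbsW hm0 hf_int hf_cont hf_nonneg hFTg (fun k => (hg0 k).le) hg1 hm
        (hL₀ _ hmL), permWeight_mul_prod]
      rfl
    simp only [gibbsE, hW]
  simp only [hlimK]
  have hsum : Tendsto (fun K : ℕ => ∑ j ∈ Finset.Icc 1 K, q j * z₀ ^ j) atTop
      (𝓝 (min ρ (∑' j, q j))) := by
    have h1 := (summable_mul_pow_of_le_one T.q_nonneg T.q_summable hz0.le hz1).hasSum
    rw [hz] at h1
    refine ((tendsto_add_atTop_iff_nat 1).2 h1.tendsto_sum_nat).congr fun K => ?_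
    rw [Finset.sum_range_succ', T.q_zero, zero_mul, add_zero, Finset.range_eq_Ico,
      Finset.sum_Ico_add' (fun j => q j * z₀ ^ j) 0 K 1]
    rfl
  have hfin : max 0 (1 - rhoC d ε α / ρ) = 1 - min ρ (∑' j, q j) / ρ := by
    rw [hrho, ← min_div_div_right hρ.le, div_self hρ.ne']
    rcases le_total 1 ((∑' j, q j) / ρ) with h | h
    · rw [min_eq_left h, max_eq_left (by linarith), sub_self]
    · rw [min_eq_right h, max_eq_right (by linarith)]
  rw [hfin]
  exact (hsum.div_const ρ).const_sub 1
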